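/- Let Ω ⊂ ℝ² be a bounded Lipschitz domain with constants ρ₀, M₀, diam(Ω) ≤ M₁ρ₀, and B_{s₀ρ₀}(x₀) ⊂ Ω. Then there exists C > 0 depending only on M₀, M₁, s₀ such that for every φ ∈ H¹(Ω, ℝ²) and every w ∈ H¹(Ω), ‖∇φ‖_{L²(Ω)} ≤ C(‖∇̂φ‖_{L²(Ω)} + (1/ρ₀)‖φ + ∇w‖_{L²(Ω)}), where ∇̂φ denotes the symmetric part of ∇φ. -/

import Mathlib

open MeasureTheory Metric

/-- A bounded domain `Ω ⊂ ℝ²` has boundary of Lipschitz class with constants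
`ρ₀, M₀`: near each boundary point, after a rigid change of coordinates, `Ω` is the
hypograph-complement of a Lipschitz function `ψ` with `ψ(0)=0` and
`C^{0,1}` norm at most `M₀ρ₀` on `(-ρ₀/M₀, ρ₀/M₀)`. -/
def LipschitzBoundary (Ω : Set (EuclideanSpace ℝ (Fin 2))) (ρ₀ M₀ : ℝ) : Prop :=
  ∀ P ∈ frontier Ω, ∃ (f : EuclideanSpace ℝ (Fin 2) ≃ᵢ EuclideanSpace ℝ (Fin 2))
    (ψ : ℝ → ℝ), f P = 0 ∧ ψ 0 = 0 ∧
    LipschitzWith (Real.toNNReal M₀) ψ ∧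
    (∀ t : ℝ, |t| < ρ₀ / M₀ → |ψ t| ≤ M₀ * ρ₀) ∧
    (∀ x : EuclideanSpace ℝ (Fin 2), |f x 0| < ρ₀ / M₀ → |f x 1| < ρ₀ →
      (x ∈ Ω ↔ ψ (f x 0) < f x 1))

namespace KornPlate

abbrev Plane := EuclideanSpace ℝ (Fin 2)

/-- The integral of a product is continuous in a relative translation of the two factors. -/
lemma continuous_integral_mul_translate {F G : Plane → ℝ} (hF : MemLp F 2) (hG : MemLp G 2)
    (v : Plane) : Continuous fun s : ℝ => ∫ x, F x * G (x + s • v) := by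
  have : Fact ((2 : ENNReal) ≠ ⊤) := ⟨by simp⟩
  have h1 : ∀ s : ℝ, ∫ x, F x * G (x + s • v) =
      inner ℝ (DomAddAct.mk (s • v) +ᵥ hG.toLp G) (hF.toLp F) := by
    intro s
    rw [DomAddAct.mk_vadd_toLp, L2.inner_def]
    refine integral_congr_ae ?_
    have hG' : MemLp (fun x => G ((s • v) +ᵥ x)) 2 :=
      hG.comp_measurePreserving (measurePreserving_add_left volume (s • v))
    filter_upwards [hF.coeFn_toLp, hG'.coeFn_toLp] with x hx hy
    rw [hx, hy]
    simp [add_comm]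
  simp_rw [h1]
  have hc : Continuous fun s : ℝ => DomAddAct.mk (s • v) +ᵥ hG.toLp G := by
    have h0 : Continuous fun s : ℝ => (DomAddAct.mk (s • v) : Planeᵈᵃᵃ) :=
      DomAddAct.continuous_mk.comp (by fun_prop)
    exact h0.vadd continuous_const
  fun_prop

lemma integrable_prod_mul_translate {F G : Plane → ℝ} (hF : MemLp F 2) (hG : MemLp G 2)
    (hGm : Measurable G) (v : Plane) (h : ℝ) :
    Integrable (Function.uncurry fun (s : ℝ) (x : Plane) => F x * G (x + s • v))
      ((volume.restrict (Set.uIoc 0 h)).prod volume) := by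
  have hm : AEStronglyMeasurable (Function.uncurry fun (s : ℝ) (x : Plane) => F x * G (x + s • v))
      ((volume.restrict (Set.uIoc 0 h)).prod volume) := by
    refine hF.1.comp_snd.mul (Measurable.aestronglyMeasurable ?_)
    exact hGm.comp (by fun_prop)
  have hG' : ∀ s : ℝ, MemLp (fun x => G (x + s • v)) 2 := fun s =>
    hG.comp_measurePreserving (measurePreserving_add_right volume (s • v))
  rw [integrable_prod_iff hm]
  refine ⟨.of_forall fun s => hF.integrable_mul (hG' s), ?_⟩
  have hc := continuous_integral_mul_translate hF.norm hG.norm v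
  have h2 := (hc.intervalIntegrable (μ := volume) 0 h).def'
  refine h2.congr (.of_forall fun s => ?_)
  simp

lemma ae_intervalIntegrable_translate {G : Plane → ℝ} (hG : Integrable G)
    (hGm : Measurable G) (v : Plane) (h : ℝ) :
    ∀ᵐ x : Plane, IntervalIntegrable (fun s : ℝ => G (x + s • v)) volume 0 h := by
  have hm : AEStronglyMeasurable (Function.uncurry fun (s : ℝ) (x : Plane) => G (x + s • v))
      ((volume.restrict (Set.uIoc 0 h)).prod volume) :=
    Measurable.aestronglyMeasurable (hGm.comp (by fun_prop))
  have hi : Integrable (Function.uncurry fun (s : ℝ) (x : Plane) => G (x + s • v))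
      ((volume.restrict (Set.uIoc 0 h)).prod volume) := by
    rw [integrable_prod_iff hm]
    refine ⟨.of_forall fun s => hG.comp_add_right (s • v), ?_⟩
    have : ∀ s : ℝ, ∫ x : Plane, ‖G (x + s • v)‖ = ∫ x, ‖G x‖ := fun s =>
      integral_add_right_eq_self (fun x => ‖G x‖) (s • v)
    simp only [Function.uncurry_apply_pair, this]
    exact (intervalIntegrable_const (μ := volume) (a := (0 : ℝ)) (b := h)).def'
  filter_upwards [hi.prod_left_ae] with x hx
  rw [intervalIntegrable_iff]
  exact hx

lemma hasDerivAt_comp_add_smul {g : Plane → ℝ} {x v : Plane} {s : ℝ}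
    (hg : DifferentiableAt ℝ g (x + s • v)) :
    HasDerivAt (fun s : ℝ => g (x + s • v)) (fderiv ℝ g (x + s • v) v) s := by
  have h1 : HasDerivAt (fun s : ℝ => x + s • v) v s := by
    simpa using ((hasDerivAt_id s).smul_const v).const_add x
  exact hg.hasFDerivAt.comp_hasDerivAt s h1

lemma hasDerivAt_integral_mul_translate {F g : Plane → ℝ} {v : Plane} (hF : MemLp F 2)
    (hg : Differentiable ℝ g) (hgc : HasCompactSupport g)
    (hG : MemLp (fun x => fderiv ℝ g x v) 2) :
    HasDerivAt (fun h : ℝ => ∫ x, F x * g (x + h • v)) (∫ x, F x * fderiv ℝ g x v) 0 := by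
  have hGm : Measurable fun x => fderiv ℝ g x v := measurable_fderiv_apply_const ℝ g v
  have hGi : Integrable fun x => fderiv ℝ g x v := by
    have : HasCompactSupport fun x => fderiv ℝ g x v := hgc.fderiv_apply ℝ v
    rw [← memLp_one_iff_integrable]
    refine hG.mono_exponent_of_measure_support_ne_top (s := tsupport fun x => fderiv ℝ g x v)
      (fun x hx => image_eq_zero_of_notMem_tsupport (f := fun x => fderiv ℝ g x v) hx) this.isCompact.measure_lt_top.ne
      (by norm_num)
  have hg2 : MemLp g 2 := hg.continuous.memLp_of_hasCompactSupport hgc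
  have hkc := continuous_integral_mul_translate hF hG v
  have key : ∀ h : ℝ, ∫ x, F x * g (x + h • v) =
      (∫ x, F x * g x) + ∫ s in (0 : ℝ)..h, ∫ x, F x * fderiv ℝ g (x + s • v) v := by
    intro h
    have hg2' : MemLp (fun x => g (x + h • v)) 2 :=
      hg2.comp_measurePreserving (measurePreserving_add_right volume (h • v))
    rw [intervalIntegral_integral_swap (integrable_prod_mul_translate hF hG hGm v h)]
    have hsub := integral_sub (hF.integrable_mul hg2') (hF.integrable_mul hg2)
    simp only [Pi.mul_apply] at hsub
    rw [eq_comm, ← eq_sub_iff_add_eq', ← hsub]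
    refine integral_congr_ae ?_
    filter_upwards [ae_intervalIntegrable_translate hGi hGm v h] with x hx
    rw [intervalIntegral.integral_const_mul,
      intervalIntegral.integral_eq_sub_of_hasDerivAt (f := fun s => g (x + s • v))
      (fun s _ => hasDerivAt_comp_add_smul (hg _)) hx]
    simp [mul_sub]
  simp_rw [key]
  have := (intervalIntegral.integral_hasDerivAt_right (a := (0 : ℝ)) (b := 0)
    (hkc.intervalIntegrable 0 0) (hkc.stronglyMeasurableAtFilter _ _)
    hkc.continuousAt).const_add (∫ x, F x * g x)
  simpa using this

/-- Interchange of derivatives under an integral, without second derivatives. -/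
lemma integral_fderiv_mul_fderiv_comm {f g : Plane → ℝ} {v w : Plane}
    (hf : Differentiable ℝ f) (hfc : HasCompactSupport f)
    (hg : Differentiable ℝ g) (hgc : HasCompactSupport g)
    (hfv : MemLp (fun x => fderiv ℝ f x v) 2) (hfw : MemLp (fun x => fderiv ℝ f x w) 2)
    (hgv : MemLp (fun x => fderiv ℝ g x v) 2) (hgw : MemLp (fun x => fderiv ℝ g x w) 2) :
    ∫ x, fderiv ℝ f x v * fderiv ℝ g x w = ∫ x, fderiv ℝ f x w * fderiv ℝ g x v := by
  have hf2 : MemLp f 2 := hf.continuous.memLp_of_hasCompactSupport hfc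
  have hg2 : MemLp g 2 := hg.continuous.memLp_of_hasCompactSupport hgc
  have h1 := hasDerivAt_integral_mul_translate hfv hg hgc hgw
  have h2 : HasDerivAt (fun h : ℝ => -∫ x, fderiv ℝ g x v * f (x + h • (-w)))
      (-∫ x, fderiv ℝ g x v * fderiv ℝ f x (-w)) 0 :=
    (hasDerivAt_integral_mul_translate hgv hf hfc (by simp only [map_neg]; exact hfw.neg)).neg
  have h3 : (fun h : ℝ => ∫ x, fderiv ℝ f x v * g (x + h • w)) =
      fun h : ℝ => -∫ x, fderiv ℝ g x v * f (x + h • (-w)) := by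
    funext h
    have hsh := measurePreserving_add_right (volume : Measure Plane) (h • w)
    have hd : ∀ x, fderiv ℝ (fun x => g (x + h • w)) x v = fderiv ℝ g (x + h • w) v := fun x => by
      rw [fderiv_comp_add_right]
    have hg2' : MemLp (fun x => g (x + h • w)) 2 := hg2.comp_measurePreserving hsh
    have hgv' : MemLp (fun x => fderiv ℝ g (x + h • w) v) 2 := hgv.comp_measurePreserving hsh
    have := integral_mul_fderiv_eq_neg_fderiv_mul_of_integrable (μ := (volume : Measure Plane))
      (f := f) (g := fun x => g (x + h • w)) (v := v)
      (hfv.integrable_mul hg2') (by simp_rw [hd]; exact hf2.integrable_mul hgv')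
      (hf2.integrable_mul hg2') (fun x _ => hf x)
      (fun x _ => (hg _).comp x (by fun_prop))
    rw [← neg_eq_iff_eq_neg, ← this]
    simp_rw [hd]
    rw [← integral_add_right_eq_self (fun x => fderiv ℝ g x v * f (x + h • (-w))) (h • w)]
    refine integral_congr_ae (.of_forall fun x => ?_)
    simp [mul_comm]
  rw [h3] at h1
  have := h1.unique h2
  rw [this, ← integral_neg]
  refine integral_congr_ae (.of_forall fun x => ?_)
  simp [mul_comm]

/-- The `j`-th partial derivative of a scalar function on the plane. -/
noncomputable def pd (j : Fin 2) (u : Plane → ℝ) (x : Plane) : ℝ :=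
  fderiv ℝ u x (EuclideanSpace.single j 1)

/-- Squared norm of the symmetrized gradient of a vector field. -/
noncomputable def strainSq (u : Fin 2 → Plane → ℝ) (x : Plane) : ℝ :=
  ∑ i : Fin 2, ∑ j : Fin 2, ((pd j (u i) x + pd i (u j) x) / 2) ^ 2

/-- Squared norm of the gradient of a vector field. -/
noncomputable def gradSq (u : Fin 2 → Plane → ℝ) (x : Plane) : ℝ :=
  ∑ i : Fin 2, ∑ j : Fin 2, (pd j (u i) x) ^ 2

/-- Infinitesimal rotation of a vector field: half of its curl. -/
noncomputable def rot (u : Fin 2 → Plane → ℝ) (x : Plane) : ℝ :=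
  (pd 0 (u 1) x - pd 1 (u 0) x) / 2

lemma gradSq_eq (u : Fin 2 → Plane → ℝ) (x : Plane) :
    gradSq u x = strainSq u x + 2 * rot u x ^ 2 := by
  simp only [gradSq, strainSq, rot, Fin.sum_univ_two]
  ring

lemma strainSq_nonneg (u : Fin 2 → Plane → ℝ) (x : Plane) : 0 ≤ strainSq u x := by
  unfold strainSq; positivity

lemma gradSq_nonneg (u : Fin 2 → Plane → ℝ) (x : Plane) : 0 ≤ gradSq u x := by
  unfold gradSq; positivity

lemma strainSq_le_gradSq (u : Fin 2 → Plane → ℝ) (x : Plane) : strainSq u x ≤ gradSq u x := by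
  rw [gradSq_eq]; nlinarith [sq_nonneg (rot u x)]

lemma rot_sq_le_gradSq (u : Fin 2 → Plane → ℝ) (x : Plane) : rot u x ^ 2 ≤ gradSq u x := by
  rw [gradSq_eq]; nlinarith [sq_nonneg (rot u x), strainSq_nonneg u x]

lemma pd_sq_le_gradSq (u : Fin 2 → Plane → ℝ) (i j : Fin 2) (x : Plane) :
    pd j (u i) x ^ 2 ≤ gradSq u x := by
  simp only [gradSq, Fin.sum_univ_two]
  fin_cases i <;> fin_cases j <;> simp <;>
    nlinarith [sq_nonneg (pd 0 (u 0) x), sq_nonneg (pd 1 (u 0) x), sq_nonneg (pd 0 (u 1) x),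
      sq_nonneg (pd 1 (u 1) x)]

@[fun_prop]
lemma measurable_pd (j : Fin 2) (u : Plane → ℝ) : Measurable (pd j u) :=
  measurable_fderiv_apply_const ℝ u _

@[fun_prop]
lemma measurable_strainSq (u : Fin 2 → Plane → ℝ) : Measurable (strainSq u) := by
  unfold strainSq; fun_prop

@[fun_prop]
lemma measurable_gradSq (u : Fin 2 → Plane → ℝ) : Measurable (gradSq u) := by
  unfold gradSq; fun_prop

@[fun_prop]
lemma measurable_rot (u : Fin 2 → Plane → ℝ) : Measurable (rot u) := by
  unfold rot; fun_prop

lemma memLp_two_of_lintegral_sq {f g : Plane → ℝ} (hf : Measurable f)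
    (hfg : ∀ x, f x ^ 2 ≤ g x) (hg : ∫⁻ x, ENNReal.ofReal (g x) < ⊤) : MemLp f 2 := by
  rw [memLp_two_iff_integrable_sq hf.aestronglyMeasurable]
  refine ⟨(hf.pow_const 2).aestronglyMeasurable, ?_⟩
  rw [hasFiniteIntegral_iff_ofReal (.of_forall fun x => sq_nonneg _)]
  exact (lintegral_mono fun x => ENNReal.ofReal_le_ofReal (hfg x)).trans_lt hg

/-- First Korn inequality for compactly supported fields. -/
lemma lintegral_rot_sq_le {v : Fin 2 → Plane → ℝ} (hv : ∀ i, Differentiable ℝ (v i))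
    (hvc : ∀ i, HasCompactSupport (v i)) (hg : ∫⁻ x, ENNReal.ofReal (gradSq v x) < ⊤) :
    ∫⁻ x, ENNReal.ofReal (rot v x ^ 2) ≤ ∫⁻ x, ENNReal.ofReal (strainSq v x) := by
  have hL : ∀ i j, MemLp (pd j (v i)) 2 := fun i j =>
    memLp_two_of_lintegral_sq (measurable_pd _ _) (pd_sq_le_gradSq v i j) hg
  have hr : MemLp (rot v) 2 :=
    memLp_two_of_lintegral_sq (measurable_rot _) (rot_sq_le_gradSq v) hg
  have hs : Integrable (strainSq v) := by
    refine ⟨(measurable_strainSq v).aestronglyMeasurable, ?_⟩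
    rw [hasFiniteIntegral_iff_ofReal (.of_forall fun x => strainSq_nonneg _ _)]
    exact (lintegral_mono fun x => ENNReal.ofReal_le_ofReal (strainSq_le_gradSq v x)).trans_lt hg
  rw [← ofReal_integral_eq_lintegral_ofReal hr.integrable_sq (.of_forall fun x => sq_nonneg _),
    ← ofReal_integral_eq_lintegral_ofReal hs (.of_forall fun x => strainSq_nonneg _ _)]
  refine ENNReal.ofReal_le_ofReal ?_
  have hcomm : ∫ x, pd 0 (v 1) x * pd 1 (v 0) x = ∫ x, pd 1 (v 1) x * pd 0 (v 0) x :=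
    integral_fderiv_mul_fderiv_comm (hv 1) (hvc 1) (hv 0) (hvc 0) (hL 1 0) (hL 1 1) (hL 0 0)
      (hL 0 1)
  have i1 : Integrable fun x => pd 0 (v 1) x * pd 1 (v 0) x := (hL 1 0).integrable_mul (hL 0 1)
  have i2 : Integrable fun x => pd 1 (v 1) x * pd 0 (v 0) x := (hL 1 1).integrable_mul (hL 0 0)
  have h0 : ∫ x, (pd 1 (v 1) x * pd 0 (v 0) x - pd 0 (v 1) x * pd 1 (v 0) x) = 0 := by
    rw [integral_sub i2 i1, hcomm, sub_self]
  have h1 : ∫ x, (strainSq v x + (pd 1 (v 1) x * pd 0 (v 0) x - pd 0 (v 1) x * pd 1 (v 0) x)) =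
      ∫ x, strainSq v x := by
    have := integral_add hs (i2.sub i1)
    simp only [Pi.sub_apply] at this
    rw [this, h0, add_zero]
  rw [← h1]
  refine integral_mono hr.integrable_sq (hs.add (i2.sub i1)) fun x => ?_
  simp only [strainSq, rot, Fin.sum_univ_two]
  nlinarith [sq_nonneg (pd 0 (v 0) x + pd 1 (v 1) x), sq_nonneg (pd 0 (v 0) x),
    sq_nonneg (pd 1 (v 1) x), sq_nonneg (pd 0 (v 1) x - pd 1 (v 0) x),
    sq_nonneg (pd 0 (v 1) x + pd 1 (v 0) x)]

lemma fderiv_apply_eq_sum_pd {u : Plane → ℝ} (x k : Plane) :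
    fderiv ℝ u x k = k 0 * pd 0 u x + k 1 * pd 1 u x := by
  have hk : k = k 0 • EuclideanSpace.single 0 1 + k 1 • EuclideanSpace.single 1 1 := by
    ext i; fin_cases i <;> simp
  conv_lhs => rw [hk]
  simp [pd]

lemma norm_sq_eq_coords (k : Plane) : ‖k‖ ^ 2 = k 0 ^ 2 + k 1 ^ 2 := by
  simp [EuclideanSpace.norm_sq_eq]

/-- The increment of `u` along a segment, projected on the segment, only sees the strain. -/
lemma segment_strain_bound {u : Fin 2 → Plane → ℝ} {x k : Plane}
    (hu : ∀ i, ∀ s ∈ Set.Icc (0 : ℝ) 1, DifferentiableAt ℝ (u i) (x + s • k)) :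
    ENNReal.ofReal ((∑ i, (u i (x + k) - u i x) * k i) ^ 2) ≤
      ENNReal.ofReal (‖k‖ ^ 4) *
        ∫⁻ s in Set.Icc (0 : ℝ) 1, ENNReal.ofReal (strainSq u (x + s • k)) := by
  rcases eq_or_ne k 0 with rfl | hk
  · simp
  have hk4 : 0 < ‖k‖ ^ 4 := by positivity
  by_cases hfin : ∫⁻ s in Set.Icc (0 : ℝ) 1, ENNReal.ofReal (strainSq u (x + s • k)) = ⊤
  · rw [hfin, ENNReal.mul_top (by simpa using hk)]
    exact le_top
  set q : ℝ → ℝ := fun s => ∑ i, fderiv ℝ (u i) (x + s • k) k * k i with hq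
  have hqm : Measurable q := by
    refine Finset.measurable_sum _ fun i _ => ?_
    exact ((measurable_fderiv_apply_const ℝ (u i) k).comp (by fun_prop)).mul_const _
  have hqle : ∀ s, q s ^ 2 ≤ ‖k‖ ^ 4 * strainSq u (x + s • k) := by
    intro s
    simp only [hq, fderiv_apply_eq_sum_pd, strainSq, Fin.sum_univ_two]
    have : ‖k‖ ^ 4 = (k 0 ^ 2 + k 1 ^ 2) ^ 2 := by rw [← norm_sq_eq_coords]; ring
    rw [this]
    generalize pd 0 (u 0) (x + s • k) = a
    generalize pd 1 (u 1) (x + s • k) = b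
    generalize pd 0 (u 1) (x + s • k) = c
    generalize pd 1 (u 0) (x + s • k) = d
    generalize k 0 = p
    generalize k 1 = r
    obtain ⟨e, he⟩ : ∃ e, e = (c + d) / 2 := ⟨_, rfl⟩
    have h1 : (p * a + r * d) * p + (p * c + r * b) * r = p ^ 2 * a + 2 * (p * r) * e + r ^ 2 * b := by
      rw [he]; ring
    have h2 : (d + c) / 2 = e := by rw [he]; ring
    rw [h1, h2, ← he]
    have : ((a + a) / 2) ^ 2 + e ^ 2 + (e ^ 2 + ((b + b) / 2) ^ 2) = a ^ 2 + 2 * e ^ 2 + b ^ 2 := by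
      ring
    rw [this]
    nlinarith [sq_nonneg (p ^ 2 * e - p * r * a), sq_nonneg (p ^ 2 * b - r ^ 2 * a),
      sq_nonneg (r ^ 2 * e - p * r * b)]
  have hint : ∫⁻ s in Set.Icc (0 : ℝ) 1, ENNReal.ofReal (q s ^ 2) ≤ ENNReal.ofReal (‖k‖ ^ 4) *
      ∫⁻ s in Set.Icc (0 : ℝ) 1, ENNReal.ofReal (strainSq u (x + s • k)) := by
    rw [← lintegral_const_mul' _ _ ENNReal.ofReal_ne_top]
    refine lintegral_mono fun s => ?_
    rw [← ENNReal.ofReal_mul hk4.le]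
    exact ENNReal.ofReal_le_ofReal (hqle s)
  refine le_trans ?_ hint
  have hq2 : MemLp q 2 (volume.restrict (Set.Icc (0 : ℝ) 1)) := by
    rw [memLp_two_iff_integrable_sq hqm.aestronglyMeasurable]
    refine ⟨(hqm.pow_const 2).aestronglyMeasurable, ?_⟩
    rw [hasFiniteIntegral_iff_ofReal (.of_forall fun x => sq_nonneg _)]
    exact hint.trans_lt (ENNReal.mul_lt_top ENNReal.ofReal_lt_top (lt_top_iff_ne_top.2 hfin))
  have hq1 : IntegrableOn q (Set.Icc (0 : ℝ) 1) := hq2.integrable (by norm_num)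
  have hftc : ∫ s in (0 : ℝ)..1, q s = ∑ i, (u i (x + k) - u i x) * k i := by
    rw [intervalIntegral.integral_eq_sub_of_hasDerivAt
      (f := fun s => ∑ i, u i (x + s • k) * k i)]
    · simp [sub_mul]
    · intro s hs
      rw [Set.uIcc_of_le zero_le_one] at hs
      exact HasDerivAt.fun_sum fun i _ => (hasDerivAt_comp_add_smul (hu i s hs)).mul_const _
    · rw [intervalIntegrable_iff_integrableOn_Icc_of_le zero_le_one]; exact hq1
  rw [← hftc, intervalIntegral.integral_of_le zero_le_one, ← integral_Icc_eq_integral_Ioc,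
    ← ofReal_integral_eq_lintegral_ofReal hq2.integrable_sq (.of_forall fun x => sq_nonneg _)]
  refine ENNReal.ofReal_le_ofReal ?_
  set m := ∫ s in Set.Icc (0 : ℝ) 1, q s
  have h0 : 0 ≤ ∫ s in Set.Icc (0 : ℝ) 1, (q s - m) ^ 2 := integral_nonneg fun s => sq_nonneg _
  have h1 : ∫ s in Set.Icc (0 : ℝ) 1, (q s - m) ^ 2 =
      ∫ s in Set.Icc (0 : ℝ) 1, (q s ^ 2 - (2 * m * q s - m ^ 2)) :=
    integral_congr_ae (.of_forall fun s => by ring)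
  have i2 : Integrable (fun s => 2 * m * q s - m ^ 2) (volume.restrict (Set.Icc (0 : ℝ) 1)) :=
    (hq1.const_mul _).sub (integrable_const _)
  rw [h1, integral_sub hq2.integrable_sq i2, integral_sub (hq1.const_mul _) (integrable_const _),
    integral_const_mul] at h0
  simp only [integral_const] at h0
  simp at h0
  have : ∫ s in Set.Icc (0 : ℝ) 1, q s = m := rfl
  nlinarith

/-- Averaged form of the segment bound for a fixed displacement. -/
lemma lintegral_segment_bound {u : Fin 2 → Plane → ℝ} {U S : Set Plane} (hU : Convex ℝ U)
    (hUo : IsOpen U) (hu : ∀ i, DifferentiableOn ℝ (u i) U) {k : Plane} (hS : S ⊆ U)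
    (hSk : ∀ x ∈ S, x + k ∈ U) (hSm : MeasurableSet S) :
    ∫⁻ x in S, ENNReal.ofReal ((∑ i, (u i (x + k) - u i x) * k i) ^ 2) ≤
      ENNReal.ofReal (‖k‖ ^ 4) * ∫⁻ x in U, ENNReal.ofReal (strainSq u x) := by
  have hseg : ∀ x ∈ S, ∀ s ∈ Set.Icc (0 : ℝ) 1, x + s • k ∈ U := by
    intro x hx s hs
    have := hU (hS hx) (hSk x hx) (sub_nonneg.2 hs.2) hs.1 (by ring)
    convert this using 1
    module
  have hm : Measurable fun x => U.indicator (fun x => ENNReal.ofReal (strainSq u x)) x :=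
    (measurable_strainSq u).ennreal_ofReal.indicator hUo.measurableSet
  calc ∫⁻ x in S, ENNReal.ofReal ((∑ i, (u i (x + k) - u i x) * k i) ^ 2)
      ≤ ∫⁻ x in S, ENNReal.ofReal (‖k‖ ^ 4) * ∫⁻ s in Set.Icc (0 : ℝ) 1,
          U.indicator (fun x => ENNReal.ofReal (strainSq u x)) (x + s • k) := by
        refine setLIntegral_mono' hSm fun x hx => ?_
        refine (segment_strain_bound fun i s hs =>
          (hu i).differentiableAt (hUo.mem_nhds (hseg x hx s hs))).trans ?_
        gcongr 1
        refine (setLIntegral_congr_fun measurableSet_Icc fun s hs => ?_).le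
        rw [Set.indicator_of_mem (hseg x hx s hs)]
    _ ≤ ∫⁻ x, ENNReal.ofReal (‖k‖ ^ 4) * ∫⁻ s in Set.Icc (0 : ℝ) 1,
          U.indicator (fun x => ENNReal.ofReal (strainSq u x)) (x + s • k) :=
        setLIntegral_le_lintegral _ _
    _ = ENNReal.ofReal (‖k‖ ^ 4) * ∫⁻ s in Set.Icc (0 : ℝ) 1, ∫⁻ x,
          U.indicator (fun x => ENNReal.ofReal (strainSq u x)) (x + s • k) := by
        rw [lintegral_const_mul' _ _ ENNReal.ofReal_ne_top, lintegral_lintegral_swap]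
        exact (hm.comp (by fun_prop)).aemeasurable
    _ = ENNReal.ofReal (‖k‖ ^ 4) * ∫⁻ x in U, ENNReal.ofReal (strainSq u x) := by
        congr 1
        simp_rw [lintegral_add_right_eq_self
          (fun x => U.indicator (fun x => ENNReal.ofReal (strainSq u x)) x)]
        rw [lintegral_indicator hUo.measurableSet]
        simp

/-- Squared increment of `u` between two points, projected on the segment joining them. -/
def projIncr (u : Fin 2 → Plane → ℝ) (x y : Plane) : ℝ :=
  (∑ i, (u i y - u i x) * (y i - x i)) ^ 2

lemma measurable_projIncr {u : Fin 2 → Plane → ℝ} (hu : ∀ i, Measurable (u i)) :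
    Measurable fun p : Plane × Plane => projIncr u p.1 p.2 := by
  unfold projIncr
  refine Measurable.pow_const (Finset.measurable_sum _ fun i _ => ?_) _
  exact (((hu i).comp measurable_snd).sub ((hu i).comp measurable_fst)).mul (by fun_prop)

lemma lintegral_projIncr_translate {u : Fin 2 → Plane → ℝ} {U S : Set Plane} (hU : Convex ℝ U)
    (hUo : IsOpen U) (hu : ∀ i, DifferentiableOn ℝ (u i) U) {k : Plane} (hS : S ⊆ U)
    (hSk : ∀ x ∈ S, x + k ∈ U) (hSm : MeasurableSet S) :
    ∫⁻ x in S, ENNReal.ofReal (projIncr u x (x + k)) ≤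
      ENNReal.ofReal (‖k‖ ^ 4) * ∫⁻ x in U, ENNReal.ofReal (strainSq u x) := by
  simpa [projIncr] using lintegral_segment_bound hU hUo hu hS hSk hSm

lemma lintegral_lintegral_projIncr_le {u : Fin 2 → Plane → ℝ} (hum : ∀ i, Measurable (u i))
    (hu : ∀ i, DifferentiableOn ℝ (u i) (ball 0 2)) :
    ∫⁻ x in ball (0 : Plane) 2, ∫⁻ y in ball (0 : Plane) 2, ENNReal.ofReal (projIncr u x y) ≤
      ENNReal.ofReal 256 * volume (ball (0 : Plane) 4) *
        ∫⁻ x in ball 0 2, ENNReal.ofReal (strainSq u x) := by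
  obtain ⟨U, hU⟩ : ∃ U, U = ball (0 : Plane) 2 := ⟨_, rfl⟩
  rw [← hU] at hu ⊢
  have hP := (measurable_projIncr hum).ennreal_ofReal
  have hUm : MeasurableSet U := hU ▸ measurableSet_ball
  have hm : Measurable fun p : Plane × Plane =>
      U.indicator (fun y => ENNReal.ofReal (projIncr u p.1 y)) (p.1 + p.2) := by
    have : (fun p : Plane × Plane =>
      U.indicator (fun y => ENNReal.ofReal (projIncr u p.1 y)) (p.1 + p.2)) =
      ((fun p : Plane × Plane => p.1 + p.2) ⁻¹' U).indicator
        (fun p => ENNReal.ofReal (projIncr u p.1 (p.1 + p.2))) := by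
      ext p
      by_cases hp : p.1 + p.2 ∈ U
      · rw [Set.indicator_of_mem hp, Set.indicator_of_mem (by exact hp)]
      · rw [Set.indicator_of_notMem hp, Set.indicator_of_notMem (by exact hp)]
    rw [this]
    refine Measurable.indicator ?_ (hUm.preimage (by fun_prop))
    exact hP.comp (f := fun p : Plane × Plane => (p.1, p.1 + p.2)) (by fun_prop)
  calc ∫⁻ x in U, ∫⁻ y in U, ENNReal.ofReal (projIncr u x y)
      = ∫⁻ x in U, ∫⁻ k in ball (0 : Plane) 4,
          U.indicator (fun y => ENNReal.ofReal (projIncr u x y)) (x + k) := by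
        refine setLIntegral_congr_fun hUm fun x hx => ?_
        rw [← lintegral_indicator hUm, ← lintegral_indicator measurableSet_ball,
          ← lintegral_add_left_eq_self _ x]
        refine lintegral_congr fun k => ?_
        by_cases hk : k ∈ ball (0 : Plane) 4
        · rw [Set.indicator_of_mem hk]
        · rw [Set.indicator_of_notMem hk, Set.indicator_of_notMem]
          intro hxk
          apply hk
          simp only [hU, mem_ball_zero_iff] at hx hxk ⊢
          have := norm_sub_le (x + k) x
          simp only [add_sub_cancel_left] at this
          linarith
    _ = ∫⁻ k in ball (0 : Plane) 4, ∫⁻ x in U,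
          U.indicator (fun y => ENNReal.ofReal (projIncr u x y)) (x + k) :=
        lintegral_lintegral_swap hm.aemeasurable
    _ ≤ ∫⁻ k in ball (0 : Plane) 4, ENNReal.ofReal 256 *
          ∫⁻ x in U, ENNReal.ofReal (strainSq u x) := by
        refine setLIntegral_mono' measurableSet_ball fun k hk => ?_
        have hS : MeasurableSet (U ∩ {x | x + k ∈ U}) :=
          hUm.inter (hUm.preimage (f := fun x => x + k) (by fun_prop))
        have h1 : ∫⁻ x in U, U.indicator (fun y => ENNReal.ofReal (projIncr u x y)) (x + k) =
            ∫⁻ x in U ∩ {x | x + k ∈ U}, ENNReal.ofReal (projIncr u x (x + k)) := by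
          rw [← lintegral_indicator hUm, ← lintegral_indicator hS]
          refine lintegral_congr fun x => ?_
          by_cases h1 : x ∈ U <;> by_cases h2 : x + k ∈ U <;> simp [h1, h2]
        rw [h1]
        refine (lintegral_projIncr_translate (hU ▸ convex_ball 0 2) (hU ▸ isOpen_ball) hu
          Set.inter_subset_left (fun x hx => hx.2) hS).trans ?_
        gcongr
        rw [mem_ball_zero_iff] at hk
        calc ‖k‖ ^ 4 ≤ 4 ^ 4 := by gcongr
          _ = 256 := by norm_num
    _ = _ := by
        rw [lintegral_const, Measure.restrict_apply_univ]
        ring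

lemma rigid_algebra {p q : ℝ} (hp : |p| ≤ 3) (hq : |q| ≤ 3) (p1 p2 p3 s n r : ℝ) :
    (p1 - p2 - s * (p - 1)) ^ 2 + (p1 - p3 - (s + n - r) * p - n * (q - 1)) ^ 2 ≤
      300 * (p1 ^ 2 + p2 ^ 2 + p3 ^ 2 + (s ^ 2 + n ^ 2 + r ^ 2)) := by
  have hp2 : p ^ 2 ≤ 9 := by rw [← sq_abs]; nlinarith [abs_nonneg p]
  have hp3 : (p - 1) ^ 2 ≤ 16 := by nlinarith [abs_le.1 hp]
  have hq3 : (q - 1) ^ 2 ≤ 16 := by nlinarith [abs_le.1 hq]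
  have k1 : (p1 - p2 - s * (p - 1)) ^ 2 ≤ 3 * (p1 ^ 2 + p2 ^ 2 + s ^ 2 * (p - 1) ^ 2) := by
    nlinarith [sq_nonneg (p1 + p2), sq_nonneg (p1 + s * (p - 1)), sq_nonneg (p2 - s * (p - 1))]
  have k2 : (p1 - p3 - (s + n - r) * p - n * (q - 1)) ^ 2 ≤
      4 * (p1 ^ 2 + p3 ^ 2 + (s + n - r) ^ 2 * p ^ 2 + n ^ 2 * (q - 1) ^ 2) := by
    generalize (s + n - r) = m
    nlinarith [sq_nonneg (p1 + p3), sq_nonneg (p1 + m * p), sq_nonneg (p1 + n * (q - 1)),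
      sq_nonneg (p3 - m * p), sq_nonneg (p3 - n * (q - 1)), sq_nonneg (m * p - n * (q - 1))]
  have k3 : (s + n - r) ^ 2 ≤ 3 * (s ^ 2 + n ^ 2 + r ^ 2) := by
    nlinarith [sq_nonneg (s - n), sq_nonneg (s + r), sq_nonneg (n + r)]
  have k4 : s ^ 2 * (p - 1) ^ 2 ≤ s ^ 2 * 16 := by gcongr
  have k5 : (s + n - r) ^ 2 * p ^ 2 ≤ 3 * (s ^ 2 + n ^ 2 + r ^ 2) * 9 := by gcongr
  have k6 : n ^ 2 * (q - 1) ^ 2 ≤ n ^ 2 * 16 := by gcongr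
  linarith [sq_nonneg p1, sq_nonneg p2, sq_nonneg p3, sq_nonneg s, sq_nonneg n, sq_nonneg r]

/-- A field whose projected increments towards the vertices of a right triangle are small is close
to an infinitesimal rigid motion. -/
lemma rigid_approx_pointwise (u : Fin 2 → Plane → ℝ) {x h : Plane} (hx : ‖x‖ ≤ 2) (hh : ‖h‖ ≤ 1) :
    (u 0 x - (u 0 h - (u 1 (EuclideanSpace.single 0 1 + h) - u 1 h) * (x 1 - h 1))) ^ 2 +
      (u 1 x - (u 1 h + (u 1 (EuclideanSpace.single 0 1 + h) - u 1 h) * (x 0 - h 0))) ^ 2 ≤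
    300 * (projIncr u x h + projIncr u x (EuclideanSpace.single 0 1 + h) +
      projIncr u x (EuclideanSpace.single 1 1 + h) +
      (projIncr u h (EuclideanSpace.single 0 1 + h) +
      projIncr u h (EuclideanSpace.single 1 1 + h) +
      projIncr u (EuclideanSpace.single 0 1 + h) (EuclideanSpace.single 1 1 + h))) := by
  have hcoord : ∀ (z : Plane) (i : Fin 2), |z i| ≤ ‖z‖ := fun z i => by
    simpa using PiLp.norm_apply_le z i
  have hp : |x 0 - h 0| ≤ 3 := by
    have := hcoord x 0; have := hcoord h 0; have := abs_sub (x 0) (h 0); linarith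
  have hq : |x 1 - h 1| ≤ 3 := by
    have := hcoord x 1; have := hcoord h 1; have := abs_sub (x 1) (h 1); linarith
  simp only [projIncr, Fin.sum_univ_two]
  simp only [PiLp.add_apply, PiLp.single_apply]
  simp
  set y2 : Plane := EuclideanSpace.single 0 1 + h
  set y3 : Plane := EuclideanSpace.single 1 1 + h
  generalize hp' : x 0 - h 0 = p at *
  generalize hq' : x 1 - h 1 = q at *
  have e1 : h 0 - x 0 = -p := by linarith
  have e2 : h 1 - x 1 = -q := by linarith
  have e3 : 1 + h 0 - x 0 = 1 - p := by linarith
  have e4 : 1 + h 1 - x 1 = 1 - q := by linarith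
  simp only [e1, e2, e3, e4]
  obtain ⟨p1, h1⟩ : ∃ t, t = (u 0 h - u 0 x) * (-p) + (u 1 h - u 1 x) * (-q) := ⟨_, rfl⟩
  obtain ⟨p2, h2⟩ : ∃ t, t = (u 0 y2 - u 0 x) * (1 - p) + (u 1 y2 - u 1 x) * (-q) := ⟨_, rfl⟩
  obtain ⟨p3, h3⟩ : ∃ t, t = (u 0 y3 - u 0 x) * (-p) + (u 1 y3 - u 1 x) * (1 - q) := ⟨_, rfl⟩
  obtain ⟨s, hs⟩ : ∃ t, t = u 0 y2 - u 0 h := ⟨_, rfl⟩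
  obtain ⟨n, hn⟩ : ∃ t, t = u 1 y3 - u 1 h := ⟨_, rfl⟩
  obtain ⟨r, hr⟩ : ∃ t, t = u 0 y2 - u 0 y3 + (u 1 y3 - u 1 y2) := ⟨_, rfl⟩
  have g0 : u 0 x - (u 0 h - (u 1 y2 - u 1 h) * q) = p1 - p2 - s * (p - 1) := by
    rw [h1, h2, hs]; ring
  have g1 : u 1 x - (u 1 h + (u 1 y2 - u 1 h) * p) =
      p1 - p3 - (s + n - r) * p - n * (q - 1) := by
    rw [h1, h3, hs, hn, hr]; ring
  rw [g0, g1, ← h1, ← h2, ← h3, ← hs, ← hn, ← hr]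
  exact rigid_algebra hp hq p1 p2 p3 s n r

lemma setLIntegral_ball_comp_add_left (G : Plane → ENNReal) (c a : Plane) (r : ℝ) :
    ∫⁻ h in ball a r, G (c + h) = ∫⁻ y in ball (c + a) r, G y := by
  have := lintegral_add_left_eq_self (μ := volume) (fun y => (ball (c + a) r).indicator G y) c
  rw [← lintegral_indicator measurableSet_ball, ← lintegral_indicator measurableSet_ball, ← this]
  refine lintegral_congr fun h => ?_
  by_cases hh : h ∈ ball a r
  · rw [Set.indicator_of_mem hh, Set.indicator_of_mem]
    simpa using hh
  · rw [Set.indicator_of_notMem hh, Set.indicator_of_notMem]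
    simpa using hh

lemma lintegral_ball_half_le {G : Plane → ENNReal} {c : Plane} (hc : ‖c‖ ≤ 1) :
    ∫⁻ h in ball (0 : Plane) (1 / 2), G (c + h) ≤ ∫⁻ y in ball (0 : Plane) 2, G y := by
  rw [setLIntegral_ball_comp_add_left]
  refine lintegral_mono_set (ball_subset_ball' ?_)
  rw [add_zero, dist_zero_right]; linarith

lemma lintegral_add_three {μ : Measure Plane} {f g : Plane → ENNReal} (hf : Measurable f)
    (hg : Measurable g) (k : Plane → ENNReal) :
    ∫⁻ x, (f x + g x + k x) ∂μ = ∫⁻ x, f x ∂μ + ∫⁻ x, g x ∂μ + ∫⁻ x, k x ∂μ := by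
  rw [lintegral_add_left (f := fun x => f x + g x) (hf.add hg), lintegral_add_left hf]

lemma lintegral_add_four {μ : Measure Plane} {f g k : Plane → ENNReal} (hf : Measurable f)
    (hg : Measurable g) (hk : Measurable k) (l : Plane → ENNReal) :
    ∫⁻ x, (f x + g x + k x + l x) ∂μ =
      ∫⁻ x, f x ∂μ + ∫⁻ x, g x ∂μ + ∫⁻ x, k x ∂μ + ∫⁻ x, l x ∂μ := by
  rw [lintegral_add_left (f := fun x => f x + g x + k x) ((hf.add hg).add hk),
    lintegral_add_three hf hg]

lemma lintegral_projIncr_vertices_le {u : Fin 2 → Plane → ℝ}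
    (hu : ∀ i, DifferentiableOn ℝ (u i) (ball 0 2)) {c d : Plane} (hc : ‖c‖ ≤ 1) (hd : ‖d‖ ≤ 1) :
    ∫⁻ h in ball (0 : Plane) (1 / 2), ENNReal.ofReal (projIncr u (c + h) (d + h)) ≤
      ENNReal.ofReal 16 * ∫⁻ x in ball 0 2, ENNReal.ofReal (strainSq u x) := by
  have hk : ‖d - c‖ ≤ 2 := (norm_sub_le d c).trans (by linarith)
  have h1 : ∫⁻ h in ball (0 : Plane) (1 / 2), ENNReal.ofReal (projIncr u (c + h) (d + h)) =
      ∫⁻ y in ball c (1 / 2), ENNReal.ofReal (projIncr u y (y + (d - c))) := by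
    have := setLIntegral_ball_comp_add_left
      (fun y => ENNReal.ofReal (projIncr u y (y + (d - c)))) c 0 (1 / 2)
    rw [add_zero] at this
    rw [← this]
    refine lintegral_congr fun h => ?_
    rw [show c + h + (d - c) = d + h by abel]
  rw [h1]
  refine (lintegral_projIncr_translate (convex_ball 0 2) isOpen_ball hu ?_ ?_
    measurableSet_ball).trans ?_
  · exact ball_subset_ball' (by rw [dist_zero_right]; linarith)
  · intro y hy
    rw [mem_ball_iff_norm] at hy
    rw [mem_ball_zero_iff]
    have := norm_add_le (y - c) d
    have h3 : y - c + d = y + (d - c) := by abel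
    rw [h3] at this
    linarith
  · gcongr
    calc ‖d - c‖ ^ 4 ≤ 2 ^ 4 := by gcongr
      _ = 16 := by norm_num

/-- Zero-order Poincaré–Korn inequality on a disk. -/
lemma exists_rigid_approx_of_measurable : ∃ C : NNReal, ∀ u : Fin 2 → Plane → ℝ,
    (∀ i, Measurable (u i)) → (∀ i, DifferentiableOn ℝ (u i) (ball 0 2)) →
    ∃ a₀ a₁ b : ℝ, ∫⁻ x in ball (0 : Plane) 2, ENNReal.ofReal
      ((u 0 x - (a₀ - b * x 1)) ^ 2 + (u 1 x - (a₁ + b * x 0)) ^ 2) ≤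
      C * ∫⁻ x in ball 0 2, ENNReal.ofReal (strainSq u x) := by
  obtain ⟨U, hU⟩ : ∃ U, U = ball (0 : Plane) 2 := ⟨_, rfl⟩
  obtain ⟨A, hA⟩ : ∃ A, A = ball (0 : Plane) (1 / 2) := ⟨_, rfl⟩
  obtain ⟨K, hK⟩ : ∃ K, K = ENNReal.ofReal 256 * volume (ball (0 : Plane) 4) := ⟨_, rfl⟩
  have hKt : K ≠ ⊤ := hK ▸ ENNReal.mul_ne_top ENNReal.ofReal_ne_top measure_ball_lt_top.ne
  have hA0 : volume A ≠ 0 := hA ▸ (measure_ball_pos _ _ (by norm_num)).ne'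
  have hAt : volume A ≠ ⊤ := hA ▸ measure_ball_lt_top.ne
  have hUt : volume U ≠ ⊤ := hU ▸ measure_ball_lt_top.ne
  obtain ⟨M, hM⟩ : ∃ M, M = (3 * K + 3 * ENNReal.ofReal 16) / volume A := ⟨_, rfl⟩
  have hMt : M ≠ ⊤ := by
    rw [hM]
    refine ENNReal.div_ne_top ?_ hA0
    exact ENNReal.add_ne_top.2 ⟨ENNReal.mul_ne_top (by simp) hKt,
      ENNReal.mul_ne_top (by simp) ENNReal.ofReal_ne_top⟩
  refine ⟨(ENNReal.ofReal 300 * (M + M * volume U)).toNNReal, fun u hum hu => ?_⟩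
  rw [ENNReal.coe_toNNReal (ENNReal.mul_ne_top ENNReal.ofReal_ne_top
    (ENNReal.add_ne_top.2 ⟨hMt, ENNReal.mul_ne_top hMt hUt⟩))]
  obtain ⟨I, hI⟩ : ∃ I, I = ∫⁻ x in U, ENNReal.ofReal (strainSq u x) := ⟨_, rfl⟩
  obtain ⟨e, he⟩ : ∃ e : Fin 2 → Plane, e = fun i => EuclideanSpace.single i 1 := ⟨_, rfl⟩
  have hen : ∀ i, ‖e i‖ ≤ 1 := fun i => by simp [he]
  have hP := (measurable_projIncr hum).ennreal_ofReal
  have hD := lintegral_lintegral_projIncr_le hum hu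
  rw [lintegral_lintegral_swap hP.aemeasurable] at hD
  rw [← hU, ← hI, ← hK] at hD
  have hbig : ∀ c : Plane, ‖c‖ ≤ 1 →
      ∫⁻ h in A, ∫⁻ x in U, ENNReal.ofReal (projIncr u x (c + h)) ≤ K * I := fun c hc => by
    have := lintegral_ball_half_le (G := fun y => ∫⁻ x in U, ENNReal.ofReal (projIncr u x y)) hc
    rw [← hU] at this
    rw [hA]
    exact this.trans hD
  have hver : ∀ c d : Plane, ‖c‖ ≤ 1 → ‖d‖ ≤ 1 →
      ∫⁻ h in A, ENNReal.ofReal (projIncr u (c + h) (d + h)) ≤ ENNReal.ofReal 16 * I :=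
    fun c d hc hd => by
      rw [hA, hI, hU]
      exact lintegral_projIncr_vertices_le hu hc hd
  have hmb : ∀ c : Plane, Measurable fun h =>
      ∫⁻ x in U, ENNReal.ofReal (projIncr u x (c + h)) := fun c => by
    have h1 : Measurable fun y => ∫⁻ x in U, ENNReal.ofReal (projIncr u x y) :=
      hP.lintegral_prod_left'
    exact h1.comp (measurable_const_add c)
  have hmv : ∀ c d : Plane, Measurable fun h =>
      ENNReal.ofReal (projIncr u (c + h) (d + h)) := fun c d =>
    hP.comp (f := fun h : Plane => (c + h, d + h)) (by fun_prop)
  have hz : ‖(0 : Plane)‖ ≤ 1 := by simp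
  obtain ⟨f, hf⟩ : ∃ f : Plane → ENNReal, f = fun h =>
    (∫⁻ x in U, ENNReal.ofReal (projIncr u x (0 + h))) +
    (∫⁻ x in U, ENNReal.ofReal (projIncr u x (e 0 + h))) +
    (∫⁻ x in U, ENNReal.ofReal (projIncr u x (e 1 + h))) +
    (ENNReal.ofReal (projIncr u (0 + h) (e 0 + h)) +
      ENNReal.ofReal (projIncr u (0 + h) (e 1 + h)) +
      ENNReal.ofReal (projIncr u (e 0 + h) (e 1 + h))) := ⟨_, rfl⟩
  have hfm : Measurable f := by
    rw [hf]
    exact (((hmb _).add (hmb _)).add (hmb _)).add (((hmv _ _).add (hmv _ _)).add (hmv _ _))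
  have hfi : ∫⁻ h in A, f h ≤ (3 * K + 3 * ENNReal.ofReal 16) * I := by
    rw [hf]
    beta_reduce
    rw [lintegral_add_four (hmb _) (hmb _) (hmb _), lintegral_add_three (hmv _ _) (hmv _ _)]
    calc _ ≤ (K * I + K * I + K * I) + (ENNReal.ofReal 16 * I + ENNReal.ofReal 16 * I +
          ENNReal.ofReal 16 * I) := by
          gcongr
          · exact hbig _ hz
          · exact hbig _ (hen 0)
          · exact hbig _ (hen 1)
          · exact hver _ _ hz (hen 0)
          · exact hver _ _ hz (hen 1)
          · exact hver _ _ (hen 0) (hen 1)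
      _ = _ := by ring
  obtain ⟨h, hhA, hfh⟩ := exists_le_setLAverage hA0 hAt hfm.aemeasurable.restrict
  have hfM : f h ≤ M * I := by
    refine hfh.trans ?_
    rw [setLAverage_eq, hM, ENNReal.div_eq_inv_mul, ENNReal.div_eq_inv_mul, mul_assoc]
    gcongr
  have hh1 : ‖h‖ ≤ 1 := by
    rw [hA, mem_ball_zero_iff] at hhA; linarith
  refine ⟨u 0 h + (u 1 (e 0 + h) - u 1 h) * h 1, u 1 h - (u 1 (e 0 + h) - u 1 h) * h 0,
    u 1 (e 0 + h) - u 1 h, ?_⟩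
  rw [← hU, ← hI]
  have hUm : MeasurableSet U := hU ▸ measurableSet_ball
  have hnn : ∀ x y, 0 ≤ projIncr u x y := fun x y => sq_nonneg _
  have hmu : ∀ y, Measurable fun x => ENNReal.ofReal (projIncr u x y) := fun y =>
    hP.comp (f := fun x : Plane => (x, y)) (by fun_prop)
  rw [hf] at hfM
  simp only [zero_add] at hfM
  have hM1 := (le_add_right le_rfl).trans hfM
  have hM2 := (le_add_left le_rfl).trans hfM
  calc _ ≤ ∫⁻ x in U, ENNReal.ofReal 300 * ((ENNReal.ofReal (projIncr u x h) +
        ENNReal.ofReal (projIncr u x (e 0 + h)) + ENNReal.ofReal (projIncr u x (e 1 + h))) +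
        (ENNReal.ofReal (projIncr u h (e 0 + h)) + ENNReal.ofReal (projIncr u h (e 1 + h)) +
        ENNReal.ofReal (projIncr u (e 0 + h) (e 1 + h)))) := by
        refine setLIntegral_mono' hUm fun x hx => ?_
        have hx2 : ‖x‖ ≤ 2 := by
          rw [hU, mem_ball_zero_iff] at hx; exact hx.le
        have := rigid_approx_pointwise u hx2 hh1
        rw [← ENNReal.ofReal_add (hnn _ _) (hnn _ _),
          ← ENNReal.ofReal_add (add_nonneg (hnn _ _) (hnn _ _)) (hnn _ _),
          ← ENNReal.ofReal_add (hnn _ _) (hnn _ _),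
          ← ENNReal.ofReal_add (add_nonneg (hnn _ _) (hnn _ _)) (hnn _ _),
          ← ENNReal.ofReal_add (add_nonneg (add_nonneg (hnn _ _) (hnn _ _)) (hnn _ _))
            (add_nonneg (add_nonneg (hnn _ _) (hnn _ _)) (hnn _ _)),
          ← ENNReal.ofReal_mul (by norm_num)]
        refine ENNReal.ofReal_le_ofReal ?_
        rw [he]
        refine le_trans (le_of_eq ?_) this
        ring
    _ = ENNReal.ofReal 300 * (((∫⁻ x in U, ENNReal.ofReal (projIncr u x h)) +
        (∫⁻ x in U, ENNReal.ofReal (projIncr u x (e 0 + h))) +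
        (∫⁻ x in U, ENNReal.ofReal (projIncr u x (e 1 + h)))) +
        (ENNReal.ofReal (projIncr u h (e 0 + h)) + ENNReal.ofReal (projIncr u h (e 1 + h)) +
        ENNReal.ofReal (projIncr u (e 0 + h) (e 1 + h))) * volume U) := by
        rw [lintegral_const_mul' _ _ ENNReal.ofReal_ne_top,
          lintegral_add_four (hmu _) (hmu _) (hmu _), setLIntegral_const]
    _ ≤ ENNReal.ofReal 300 * (M * I + M * I * volume U) := by gcongr
    _ = _ := by ring

lemma pd_congr_of_isOpen {u v : Plane → ℝ} {U : Set Plane} (hU : IsOpen U) (h : Set.EqOn u v U)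
    (j : Fin 2) {x : Plane} (hx : x ∈ U) : pd j u x = pd j v x := by
  unfold pd
  rw [(h.eventuallyEq_of_mem (hU.mem_nhds hx)).fderiv_eq]

lemma exists_rigid_approx : ∃ C : NNReal, ∀ u : Fin 2 → Plane → ℝ,
    (∀ i, DifferentiableOn ℝ (u i) (ball 0 2)) →
    ∃ a₀ a₁ b : ℝ, ∫⁻ x in ball (0 : Plane) 2, ENNReal.ofReal
      ((u 0 x - (a₀ - b * x 1)) ^ 2 + (u 1 x - (a₁ + b * x 0)) ^ 2) ≤
      C * ∫⁻ x in ball 0 2, ENNReal.ofReal (strainSq u x) := by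
  obtain ⟨C, hC⟩ := exists_rigid_approx_of_measurable
  refine ⟨C, fun u hu => ?_⟩
  have heq : ∀ i, Set.EqOn ((ball (0 : Plane) 2).indicator (u i)) (u i) (ball 0 2) :=
    fun i => Set.eqOn_indicator
  obtain ⟨a₀, a₁, b, h⟩ := hC (fun i => (ball (0 : Plane) 2).indicator (u i))
    (fun i => by
      classical
      rw [← Set.piecewise_eq_indicator]
      exact (hu i).continuousOn.measurable_piecewise continuousOn_const measurableSet_ball)
    (fun i => (hu i).congr (heq i))
  refine ⟨a₀, a₁, b, ?_⟩
  have e1 : ∫⁻ x in ball (0 : Plane) 2,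
      ENNReal.ofReal (strainSq (fun i => (ball (0 : Plane) 2).indicator (u i)) x) =
      ∫⁻ x in ball (0 : Plane) 2, ENNReal.ofReal (strainSq u x) := by
    refine setLIntegral_congr_fun measurableSet_ball fun x hx => ?_
    simp only [strainSq, pd_congr_of_isOpen isOpen_ball (heq _) _ hx]
  rw [e1] at h
  refine le_trans (le_of_eq ?_) h
  refine setLIntegral_congr_fun measurableSet_ball fun x hx => ?_
  simp only [heq _ hx]

lemma lintegral_le_setLIntegral {S : Set Plane} (hS : MeasurableSet S) {F H : Plane → ENNReal}
    (h1 : ∀ x ∈ S, F x ≤ H x) (h0 : ∀ x ∉ S, F x = 0) : ∫⁻ x, F x ≤ ∫⁻ x in S, H x := by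
  rw [← lintegral_indicator hS]
  refine lintegral_mono fun x => ?_
  by_cases hx : x ∈ S
  · rw [Set.indicator_of_mem hx]; exact h1 x hx
  · rw [h0 x hx]; exact zero_le

lemma pd_mul {f g : Plane → ℝ} {x : Plane} (hf : DifferentiableAt ℝ f x)
    (hg : DifferentiableAt ℝ g x) (j : Fin 2) :
    pd j (fun y => f y * g y) x = f x * pd j g x + g x * pd j f x := by
  unfold pd
  rw [fderiv_fun_mul hf hg]
  simp

lemma abs_pd_le (f : Plane → ℝ) (x : Plane) (j : Fin 2) : |pd j f x| ≤ ‖fderiv ℝ f x‖ := by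
  have := (fderiv ℝ f x).le_opNorm (EuclideanSpace.single j 1)
  simpa [pd] using this

/-- The infinitesimal rigid displacements of the plane. -/
def rigid (a₀ a₁ b : ℝ) (i : Fin 2) (x : Plane) : ℝ :=
  if i = 0 then a₀ - b * x 1 else a₁ + b * x 0

lemma differentiable_rigid (a₀ a₁ b : ℝ) (i : Fin 2) : Differentiable ℝ (rigid a₀ a₁ b i) := by
  unfold rigid
  split_ifs <;> fun_prop

lemma hasFDerivAt_coord (i : Fin 2) (x : Plane) :
    HasFDerivAt (fun y : Plane => y i) (EuclideanSpace.proj i : Plane →L[ℝ] ℝ) x :=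
  (EuclideanSpace.proj i : Plane →L[ℝ] ℝ).hasFDerivAt

lemma pd_rigid_zero (a₀ a₁ b : ℝ) (j : Fin 2) (x : Plane) :
    pd j (rigid a₀ a₁ b 0) x = if j = 1 then -b else 0 := by
  have h : HasFDerivAt (rigid a₀ a₁ b 0) _ x :=
    ((hasFDerivAt_coord 1 x).const_mul b).const_sub a₀
  rw [pd, h.fderiv]
  fin_cases j <;> simp

lemma pd_rigid_one (a₀ a₁ b : ℝ) (j : Fin 2) (x : Plane) :
    pd j (rigid a₀ a₁ b 1) x = if j = 0 then b else 0 := by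
  have h : HasFDerivAt (rigid a₀ a₁ b 1) _ x :=
    ((hasFDerivAt_coord 0 x).const_mul b).const_add a₁
  rw [pd, h.fderiv]
  fin_cases j <;> simp

lemma pd_sub {f g : Plane → ℝ} {x : Plane} (hf : DifferentiableAt ℝ f x)
    (hg : DifferentiableAt ℝ g x) (j : Fin 2) :
    pd j (fun y => f y - g y) x = pd j f x - pd j g x := by
  unfold pd
  rw [fderiv_fun_sub hf hg]
  simp

lemma strainSq_sub_rigid {u : Fin 2 → Plane → ℝ} {x : Plane}
    (hu : ∀ i, DifferentiableAt ℝ (u i) x) (a₀ a₁ b : ℝ) :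
    strainSq (fun i y => u i y - rigid a₀ a₁ b i y) x = strainSq u x := by
  simp only [strainSq, Fin.sum_univ_two, pd_sub (hu _) (differentiable_rigid a₀ a₁ b _ x),
    pd_rigid_zero, pd_rigid_one]
  simp

lemma rot_sub_rigid {u : Fin 2 → Plane → ℝ} {x : Plane}
    (hu : ∀ i, DifferentiableAt ℝ (u i) x) (a₀ a₁ b : ℝ) :
    rot (fun i y => u i y - rigid a₀ a₁ b i y) x = rot u x - b := by
  simp only [rot, pd_sub (hu _) (differentiable_rigid a₀ a₁ b _ x), pd_rigid_zero, pd_rigid_one]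
  simp
  ring

lemma strainSq_mul_le {χ : Plane → ℝ} {d : Fin 2 → Plane → ℝ} {x : Plane} {G : ℝ}
    (hχ : DifferentiableAt ℝ χ x) (hd : ∀ i, DifferentiableAt ℝ (d i) x) (h1 : χ x ^ 2 ≤ 1)
    (hG : ∀ j, pd j χ x ^ 2 ≤ G) :
    strainSq (fun i y => χ y * d i y) x ≤
      2 * strainSq d x + 4 * G * (d 0 x ^ 2 + d 1 x ^ 2) := by
  have hG0 : 0 ≤ G := (sq_nonneg _).trans (hG 0)
  have key : strainSq (fun i y => χ y * d i y) x ≤ 2 * (χ x ^ 2 * strainSq d x) +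
      2 * ((d 0 x ^ 2 + d 1 x ^ 2) * (pd 0 χ x ^ 2 + pd 1 χ x ^ 2)) := by
    simp only [strainSq, Fin.sum_univ_two, pd_mul hχ (hd _)]
    generalize χ x = c
    generalize pd 0 χ x = p
    generalize pd 1 χ x = q
    generalize pd 0 (d 0) x = a
    generalize pd 1 (d 0) x = e
    generalize pd 0 (d 1) x = f
    generalize pd 1 (d 1) x = g
    generalize d 0 x = r
    generalize d 1 x = s
    nlinarith [sq_nonneg (c * a - r * p), sq_nonneg (c * g - s * q),
      sq_nonneg (c * (e + f) / 2 - (r * q + s * p) / 2), sq_nonneg (r * q - s * p)]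
  have h2 : χ x ^ 2 * strainSq d x ≤ 1 * strainSq d x :=
    mul_le_mul_of_nonneg_right h1 (strainSq_nonneg d x)
  have h3 : (d 0 x ^ 2 + d 1 x ^ 2) * (pd 0 χ x ^ 2 + pd 1 χ x ^ 2) ≤
      (d 0 x ^ 2 + d 1 x ^ 2) * (2 * G) :=
    mul_le_mul_of_nonneg_left (by linarith [hG 0, hG 1]) (by positivity)
  linarith

lemma gradSq_mul_le {χ : Plane → ℝ} {d : Fin 2 → Plane → ℝ} {x : Plane} {G : ℝ}
    (hχ : DifferentiableAt ℝ χ x) (hd : ∀ i, DifferentiableAt ℝ (d i) x) (h1 : χ x ^ 2 ≤ 1)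
    (hG : ∀ j, pd j χ x ^ 2 ≤ G) :
    gradSq (fun i y => χ y * d i y) x ≤
      2 * gradSq d x + 4 * G * (d 0 x ^ 2 + d 1 x ^ 2) := by
  have key : gradSq (fun i y => χ y * d i y) x ≤ 2 * (χ x ^ 2 * gradSq d x) +
      2 * ((d 0 x ^ 2 + d 1 x ^ 2) * (pd 0 χ x ^ 2 + pd 1 χ x ^ 2)) := by
    simp only [gradSq, Fin.sum_univ_two, pd_mul hχ (hd _)]
    generalize χ x = c
    generalize pd 0 χ x = p
    generalize pd 1 χ x = q
    generalize pd 0 (d 0) x = a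
    generalize pd 1 (d 0) x = e
    generalize pd 0 (d 1) x = f
    generalize pd 1 (d 1) x = g
    generalize d 0 x = r
    generalize d 1 x = s
    nlinarith [sq_nonneg (c * a - r * p), sq_nonneg (c * g - s * q),
      sq_nonneg (c * e - r * q), sq_nonneg (c * f - s * p)]
  have h2 : χ x ^ 2 * gradSq d x ≤ 1 * gradSq d x :=
    mul_le_mul_of_nonneg_right h1 (gradSq_nonneg d x)
  have h3 : (d 0 x ^ 2 + d 1 x ^ 2) * (pd 0 χ x ^ 2 + pd 1 χ x ^ 2) ≤
      (d 0 x ^ 2 + d 1 x ^ 2) * (2 * G) :=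
    mul_le_mul_of_nonneg_left (by linarith [hG 0, hG 1]) (by positivity)
  linarith

/-- Korn's inequality on a disk, with the gradient modulo rotations controlled on a smaller
disk. -/
lemma exists_rot_approx_unit : ∃ C : NNReal, ∀ u : Fin 2 → Plane → ℝ,
    (∀ i, DifferentiableOn ℝ (u i) (ball 0 2)) →
    ∫⁻ x in ball 0 2, ENNReal.ofReal (gradSq u x) < ⊤ →
    ∃ b : ℝ, ∫⁻ x in ball 0 1, ENNReal.ofReal ((rot u x - b) ^ 2) ≤
      C * ∫⁻ x in ball 0 2, ENNReal.ofReal (strainSq u x) := by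
  obtain ⟨C, hC⟩ := exists_rigid_approx
  let χ : ContDiffBump (0 : Plane) := ⟨1, 3 / 2, by norm_num, by norm_num⟩
  have hχd : ContDiff ℝ 1 χ := χ.contDiff
  have hχD : Differentiable ℝ χ := hχd.differentiable (by norm_num)
  obtain ⟨B, hB⟩ := (hχd.continuous_fderiv (by norm_num)).bounded_above_of_compact_support
    (χ.hasCompactSupport.fderiv (𝕜 := ℝ))
  have hG : ∀ x j, pd j χ x ^ 2 ≤ B ^ 2 := fun x j =>
    sq_le_sq' (by linarith [(abs_le.1 ((abs_pd_le χ x j).trans (hB x))).1])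
      ((abs_le.1 ((abs_pd_le χ x j).trans (hB x))).2)
  have hχ1 : ∀ x, χ x ^ 2 ≤ 1 := fun x => by
    have h0 := χ.nonneg (x := x)
    have h1 := χ.le_one (x := x)
    nlinarith
  obtain ⟨K, hK⟩ : ∃ K, K = 4 * B ^ 2 := ⟨_, rfl⟩
  have hK0 : 0 ≤ K := by rw [hK]; positivity
  refine ⟨2 + K.toNNReal * C, fun u hu hfin => ?_⟩
  obtain ⟨a₀, a₁, b, hb⟩ := hC u hu
  have hud : ∀ i, ∀ x ∈ ball (0 : Plane) 2, DifferentiableAt ℝ (u i) x := fun i x hx =>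
    (hu i).differentiableAt (isOpen_ball.mem_nhds hx)
  obtain ⟨d, hd⟩ : ∃ d : Fin 2 → Plane → ℝ, d = fun i y => u i y - rigid a₀ a₁ b i y := ⟨_, rfl⟩
  have hdd : ∀ x ∈ ball (0 : Plane) 2, ∀ i, DifferentiableAt ℝ (d i) x := fun x hx i => by
    rw [hd]; exact (hud i x hx).sub (differentiable_rigid a₀ a₁ b i x)
  have hds : ∀ x ∈ ball (0 : Plane) 2, strainSq d x = strainSq u x := fun x hx => by
    rw [hd]; exact strainSq_sub_rigid (fun i => hud i x hx) _ _ _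
  have hdr : ∀ x ∈ ball (0 : Plane) 2, rot d x = rot u x - b := fun x hx => by
    rw [hd]; exact rot_sub_rigid (fun i => hud i x hx) _ _ _
  obtain ⟨I, hI⟩ : ∃ I, I = ∫⁻ x in ball (0 : Plane) 2, ENNReal.ofReal (strainSq u x) := ⟨_, rfl⟩
  have hb' : ∫⁻ x in ball (0 : Plane) 2, ENNReal.ofReal (d 0 x ^ 2 + d 1 x ^ 2) ≤ C * I := by
    rw [hI, hd]; simpa [rigid] using hb
  obtain ⟨v, hv⟩ : ∃ v : Fin 2 → Plane → ℝ, v = fun i y => χ y * d i y := ⟨_, rfl⟩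
  have hsupp : tsupport χ ⊆ ball (0 : Plane) 2 := by
    rw [χ.tsupport_eq]; exact closedBall_subset_ball (by norm_num)
  have hv0 : ∀ i, ∀ x ∉ ball (0 : Plane) 2, v i =ᶠ[nhds x] fun _ => 0 := fun i x hx => by
    have h1 := notMem_tsupport_iff_eventuallyEq.1 (fun h => hx (hsupp h))
    filter_upwards [h1] with y hy
    rw [hv]; simp [hy]
  have hvd : ∀ i, Differentiable ℝ (v i) := fun i x => by
    by_cases hx : x ∈ ball (0 : Plane) 2
    · rw [hv]; exact (hχD x).mul (hdd x hx i)
    · exact (differentiableAt_const 0).congr_of_eventuallyEq (hv0 i x hx)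
  have hvp : ∀ x ∉ ball (0 : Plane) 2, ∀ i j, pd j (v i) x = 0 := fun x hx i j => by
    rw [pd, (hv0 i x hx).fderiv_eq]; simp
  have hvc : ∀ i, HasCompactSupport (v i) := fun i => by
    rw [hv]; exact χ.hasCompactSupport.mul_right
  have hI' : I < ⊤ := by
    rw [hI]
    exact (lintegral_mono fun x => ENNReal.ofReal_le_ofReal (strainSq_le_gradSq u x)).trans_lt hfin
  have hdgfin : ∫⁻ x in ball (0 : Plane) 2,
      ENNReal.ofReal (4 * gradSq u x + 4 * b ^ 2) < ⊤ := by
    have : ∀ x, ENNReal.ofReal (4 * gradSq u x + 4 * b ^ 2) =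
        ENNReal.ofReal 4 * ENNReal.ofReal (gradSq u x) + ENNReal.ofReal (4 * b ^ 2) := fun x => by
      rw [ENNReal.ofReal_add (by have := gradSq_nonneg u x; positivity) (by positivity),
        ENNReal.ofReal_mul (by norm_num)]
    simp_rw [this]
    rw [lintegral_add_right _ measurable_const, lintegral_const_mul' _ _ ENNReal.ofReal_ne_top,
      setLIntegral_const]
    exact ENNReal.add_lt_top.2 ⟨ENNReal.mul_lt_top ENNReal.ofReal_lt_top hfin,
      ENNReal.mul_lt_top ENNReal.ofReal_lt_top measure_ball_lt_top⟩
  have hsplit : ∀ g : Plane → ℝ, Measurable g → (∀ x, 0 ≤ g x) →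
      ∫⁻ x in ball (0 : Plane) 2, ENNReal.ofReal (2 * g x + K * (d 0 x ^ 2 + d 1 x ^ 2)) ≤
      2 * (∫⁻ x in ball (0 : Plane) 2, ENNReal.ofReal (g x)) + K.toNNReal * (C * I) :=
    fun g hg hg0 => by
      have : ∀ x, ENNReal.ofReal (2 * g x + K * (d 0 x ^ 2 + d 1 x ^ 2)) =
          2 * ENNReal.ofReal (g x) + K.toNNReal * ENNReal.ofReal (d 0 x ^ 2 + d 1 x ^ 2) :=
        fun x => by
          rw [ENNReal.ofReal_add (by have := hg0 x; positivity) (by positivity),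
            ENNReal.ofReal_mul (by norm_num), ENNReal.ofReal_mul hK0, ENNReal.ofReal_ofNat]
          rfl
      simp_rw [this]
      rw [lintegral_add_left (by fun_prop), lintegral_const_mul' _ _ (by simp),
        lintegral_const_mul' _ _ (by simp)]
      gcongr
  have hvg : ∫⁻ x, ENNReal.ofReal (gradSq v x) < ⊤ := by
    refine (lintegral_le_setLIntegral measurableSet_ball (H := fun x => ENNReal.ofReal
      (2 * (4 * gradSq u x + 4 * b ^ 2) + K * (d 0 x ^ 2 + d 1 x ^ 2)))
      (fun x hx => ENNReal.ofReal_le_ofReal ?_) (fun x hx => ?_)).trans_lt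
      ((hsplit (fun x => 4 * gradSq u x + 4 * b ^ 2) (by fun_prop)
        (fun x => by have := gradSq_nonneg u x; positivity)).trans_lt ?_)
    · have h1 := gradSq_mul_le (hχD x) (hdd x hx) (hχ1 x) (hG x)
      rw [← hv, ← hK] at h1
      have h2 := gradSq_eq d x
      have h3 := gradSq_eq u x
      have h4 := strainSq_nonneg u x
      rw [hds x hx, hdr x hx] at h2
      nlinarith [sq_nonneg (rot u x + b)]
    · simp [gradSq, hvp x hx]
    · exact ENNReal.add_lt_top.2 ⟨ENNReal.mul_lt_top (by simp) hdgfin,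
        ENNReal.mul_lt_top (by simp) (ENNReal.mul_lt_top (by simp) hI')⟩
  refine ⟨b, ?_⟩
  rw [← hI]
  calc ∫⁻ x in ball (0 : Plane) 1, ENNReal.ofReal ((rot u x - b) ^ 2)
      = ∫⁻ x in ball (0 : Plane) 1, ENNReal.ofReal (rot v x ^ 2) := by
        refine setLIntegral_congr_fun measurableSet_ball fun x hx => ?_
        have hx2 : x ∈ ball (0 : Plane) 2 := ball_subset_ball (by norm_num) hx
        have heq : ∀ i, Set.EqOn (v i) (d i) (ball (0 : Plane) 1) := fun i y hy => by
          rw [hv]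
          have : χ y = 1 := χ.one_of_mem_closedBall (ball_subset_closedBall hy)
          simp [this]
        rw [← hdr x hx2]
        simp only [rot, pd_congr_of_isOpen isOpen_ball (heq _) _ hx]
    _ ≤ ∫⁻ x, ENNReal.ofReal (rot v x ^ 2) := setLIntegral_le_lintegral _ _
    _ ≤ ∫⁻ x, ENNReal.ofReal (strainSq v x) := lintegral_rot_sq_le hvd hvc hvg
    _ ≤ ∫⁻ x in ball (0 : Plane) 2,
          ENNReal.ofReal (2 * strainSq u x + K * (d 0 x ^ 2 + d 1 x ^ 2)) := by
        refine lintegral_le_setLIntegral measurableSet_ball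
          (fun x hx => ENNReal.ofReal_le_ofReal ?_) (fun x hx => ?_)
        · have h1 := strainSq_mul_le (hχD x) (hdd x hx) (hχ1 x) (hG x)
          rw [← hv, ← hK, hds x hx] at h1
          exact h1
        · simp [strainSq, hvp x hx]
    _ ≤ _ := hsplit _ (measurable_strainSq u) (strainSq_nonneg u)
    _ = _ := by rw [← hI]; push_cast; ring

lemma integrable_mul_of_continuousOn {f g : Plane → ℝ} {U : Set Plane} (hU : IsOpen U)
    (hf : ContinuousOn f U) (hg : Continuous g) (hgc : HasCompactSupport g)
    (hgU : tsupport g ⊆ U) : Integrable fun x => f x * g x := by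
  have hs : tsupport (fun x => f x * g x) ⊆ tsupport g :=
    tsupport_mul_subset_right (f := f) (g := g)
  refine Continuous.integrable_of_hasCompactSupport ?_ (hgc.mul_left (f := f))
  exact (hf.mul hg.continuousOn).continuous_of_tsupport_subset hU (hs.trans hgU)

lemma integrable_mul_of_integrableOn {f g : Plane → ℝ} {U : Set Plane}
    (hf : IntegrableOn f U) (hg : Continuous g) (hgc : HasCompactSupport g)
    (hgU : tsupport g ⊆ U) : Integrable fun x => f x * g x := by
  have hs : Function.support (fun x => f x * g x) ⊆ U := fun x hx =>
    hgU (subset_tsupport g fun h => hx (by simp [h]))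
  rw [← integrableOn_iff_integrable_of_support_subset hs]
  obtain ⟨M, hM⟩ := hg.bounded_above_of_compact_support hgc
  exact Integrable.mul_bdd (c := M) hf hg.aestronglyMeasurable (.of_forall hM)

lemma integral_mul_pd {f g : Plane → ℝ} {U : Set Plane} (hU : IsOpen U)
    (hf : DifferentiableOn ℝ f U) (hg : ContDiff ℝ 1 g) (hgc : HasCompactSupport g)
    (hgU : tsupport g ⊆ U) (j : Fin 2) (hi : Integrable fun x => pd j f x * g x) :
    ∫ x, f x * pd j g x = -∫ x, pd j f x * g x := by
  have hc : Continuous fun x => pd j g x := (hg.continuous_fderiv_apply (by norm_num)).comp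
    (continuous_id.prodMk continuous_const)
  refine integral_mul_fderiv_eq_neg_fderiv_mul_of_integrable hi ?_ ?_
    (fun x hx => hf.differentiableAt (hU.mem_nhds (hgU hx)))
    (fun x _ => hg.differentiable (by norm_num) x)
  · exact integrable_mul_of_continuousOn hU hf.continuousOn hc (hgc.fderiv_apply ℝ _)
      ((tsupport_fderiv_apply_subset ℝ _).trans hgU)
  · exact integrable_mul_of_continuousOn hU hf.continuousOn hg.continuous hgc hgU

lemma pd_comm {g : Plane → ℝ} (hg : ContDiff ℝ 2 g) (i j : Fin 2) (x : Plane) :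
    pd i (pd j g) x = pd j (pd i g) x := by
  have h := (hg.contDiffAt (x := x)).isSymmSndFDerivAt (by simp)
  have hd : DifferentiableAt ℝ (fderiv ℝ g) x :=
    ((hg.fderiv_right (m := 1) (by norm_num)).differentiable (by norm_num)) x
  have key : ∀ i j : Fin 2, pd i (pd j g) x =
      fderiv ℝ (fderiv ℝ g) x (EuclideanSpace.single i 1) (EuclideanSpace.single j 1) := by
    intro i j
    rw [pd]
    have : pd j g = fun y => fderiv ℝ g y (EuclideanSpace.single j 1) := rfl
    rw [this, fderiv_clm_apply hd (by fun_prop)]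
    simp
  rw [key, key, h.eq]

/-- The discrepancy between a displacement and minus a gradient. -/
noncomputable def shear (u : Fin 2 → Plane → ℝ) (w : Plane → ℝ) (i : Fin 2) (x : Plane) : ℝ :=
  u i x + pd i w x

/-- A gradient has no rotation: testing `u + ∇w` against a curl only sees `rot u`. -/
lemma integral_shear_mul_curl {u : Fin 2 → Plane → ℝ} {w η : Plane → ℝ} {U : Set Plane}
    (hU : IsOpen U) (hu : ∀ i, DifferentiableOn ℝ (u i) U) (hw : DifferentiableOn ℝ w U)
    (hη : ContDiff ℝ 2 η) (hηc : HasCompactSupport η) (hηU : tsupport η ⊆ U)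
    (hpu : ∀ i j, IntegrableOn (pd j (u i)) U) (hs : ∀ i, IntegrableOn (shear u w i) U) :
    ∫ x, (shear u w 0 x * pd 1 η x - shear u w 1 x * pd 0 η x) = ∫ x, 2 * (rot u x * η x) := by
  have hη1 : ContDiff ℝ 1 η := hη.of_le (by norm_num)
  have hpη : ∀ j, ContDiff ℝ 1 (pd j η) := fun j =>
    (hη.fderiv_right (m := 1) (by norm_num)).clm_apply contDiff_const
  have hpc : ∀ j, HasCompactSupport (pd j η) := fun j => hηc.fderiv_apply ℝ _
  have hpU : ∀ j, tsupport (pd j η) ⊆ U := fun j =>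
    (tsupport_fderiv_apply_subset ℝ _).trans hηU
  have i1 : ∀ i j, Integrable fun x => u i x * pd j η x := fun i j =>
    integrable_mul_of_continuousOn hU (hu i).continuousOn (hpη j).continuous (hpc j) (hpU j)
  have i2 : ∀ i j, Integrable fun x => shear u w i x * pd j η x := fun i j =>
    integrable_mul_of_integrableOn (hs i) (hpη j).continuous (hpc j) (hpU j)
  have i3 : ∀ i j, Integrable fun x => pd i w x * pd j η x := fun i j => by
    refine ((i2 i j).sub (i1 i j)).congr (.of_forall fun x => ?_)
    simp only [Pi.sub_apply, shear]; ring
  have i4 : ∀ i j, Integrable fun x => pd j (u i) x * η x := fun i j =>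
    integrable_mul_of_integrableOn (hpu i j) hη.continuous hηc hηU
  have e1 : ∀ i j, ∫ x, u i x * pd j η x = -∫ x, pd j (u i) x * η x := fun i j =>
    integral_mul_pd hU (hu i) hη1 hηc hηU j (i4 i j)
  have e2 : ∀ i j, ∫ x, w x * pd i (pd j η) x = -∫ x, pd i w x * pd j η x := fun i j =>
    integral_mul_pd hU hw (hpη j) (hpc j) (hpU j) i (i3 i j)
  have e3 : ∫ x, pd 0 w x * pd 1 η x = ∫ x, pd 1 w x * pd 0 η x := by
    have h1 := e2 0 1
    have h2 := e2 1 0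
    simp only [pd_comm hη 0 1] at h1
    linarith
  have s1 : ∀ i j, ∫ x, shear u w i x * pd j η x =
      (∫ x, u i x * pd j η x) + ∫ x, pd i w x * pd j η x := fun i j => by
    rw [← integral_add (i1 i j) (i3 i j)]
    refine integral_congr_ae (.of_forall fun x => ?_)
    simp only [shear]; ring
  have s2 : ∫ x, 2 * (rot u x * η x) =
      (∫ x, pd 0 (u 1) x * η x) - ∫ x, pd 1 (u 0) x * η x := by
    rw [← integral_sub (i4 1 0) (i4 0 1)]
    refine integral_congr_ae (.of_forall fun x => ?_)
    simp only [rot]; ring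
  rw [integral_sub (i2 0 1) (i2 1 0), s1, s1, s2, e1, e1, e3]
  ring

lemma young_shear {δ M b g k s p q e : ℝ} (hδ : 0 < δ) (hp : p ^ 2 ≤ M) (hq : q ^ 2 ≤ M)
    (he : e ^ 2 ≤ M) :
    b * (g * p - k * q - 2 * (s * e)) ≤ δ * b ^ 2 + 3 * M / δ * (g ^ 2 + k ^ 2 + s ^ 2) := by
  obtain ⟨t, ht⟩ : ∃ t, t = g * p - k * q - 2 * (s * e) := ⟨_, rfl⟩
  have h1 : b * t ≤ δ * b ^ 2 + t ^ 2 / (4 * δ) := by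
    have : 0 ≤ (2 * δ * b - t) ^ 2 / (4 * δ) := by positivity
    have h2 : (2 * δ * b - t) ^ 2 / (4 * δ) = δ * b ^ 2 - b * t + t ^ 2 / (4 * δ) := by
      field_simp; ring
    linarith
  have h2 : t ^ 2 ≤ 3 * (g ^ 2 * M + k ^ 2 * M + 4 * (s ^ 2 * M)) := by
    have a1 := mul_le_mul_of_nonneg_left hp (sq_nonneg g)
    have a2 := mul_le_mul_of_nonneg_left hq (sq_nonneg k)
    have a3 := mul_le_mul_of_nonneg_left he (sq_nonneg s)
    rw [ht]
    nlinarith [sq_nonneg (g * p + k * q), sq_nonneg (g * p + 2 * (s * e)),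
      sq_nonneg (k * q - 2 * (s * e))]
  have h3 : t ^ 2 / (4 * δ) ≤ 3 * M / δ * (g ^ 2 + k ^ 2 + s ^ 2) := by
    have hM : 0 ≤ M := (sq_nonneg _).trans hp
    rw [div_mul_eq_mul_div, div_le_div_iff₀ (by positivity) hδ]
    have : t ^ 2 ≤ 12 * M * (g ^ 2 + k ^ 2 + s ^ 2) := by nlinarith [mul_nonneg hM (sq_nonneg g), mul_nonneg hM (sq_nonneg k)]
    nlinarith
  rw [← ht]; linarith

lemma exists_rotation_bound_unit : ∃ C : ℝ, 0 ≤ C ∧ ∀ (u : Fin 2 → Plane → ℝ) (w : Plane → ℝ),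
    (∀ i, DifferentiableOn ℝ (u i) (ball 0 1)) → DifferentiableOn ℝ w (ball 0 1) →
    IntegrableOn (gradSq u) (ball 0 1) →
    IntegrableOn (fun x => shear u w 0 x ^ 2 + shear u w 1 x ^ 2) (ball 0 1) →
    ∀ b : ℝ, b ^ 2 ≤ C * ((∫ x in ball 0 1, (shear u w 0 x ^ 2 + shear u w 1 x ^ 2)) +
      ∫ x in ball 0 1, (rot u x - b) ^ 2) := by
  let η : ContDiffBump (0 : Plane) := ⟨1 / 2, 3 / 4, by norm_num, by norm_num⟩
  have hη : ContDiff ℝ 2 η := η.contDiff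
  obtain ⟨B, hB⟩ := (hη.continuous_fderiv (by norm_num)).bounded_above_of_compact_support
    (η.hasCompactSupport.fderiv (𝕜 := ℝ))
  have hp : ∀ x j, pd j η x ^ 2 ≤ B ^ 2 + 1 := fun x j => by
    have := sq_le_sq' (by linarith [(abs_le.1 ((abs_pd_le η x j).trans (hB x))).1])
      ((abs_le.1 ((abs_pd_le η x j).trans (hB x))).2)
    linarith
  have hη1 : ∀ x, η x ^ 2 ≤ B ^ 2 + 1 := fun x => by
    have h0 := η.nonneg (x := x)
    have h1 := η.le_one (x := x)
    nlinarith [sq_nonneg B]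
  have hηU : tsupport η ⊆ ball (0 : Plane) 1 := by
    rw [η.tsupport_eq]; exact closedBall_subset_ball (by norm_num)
  have hc : 0 < ∫ x, η x := η.integral_pos
  obtain ⟨c, hcd⟩ : ∃ c, c = ∫ x, η x := ⟨_, rfl⟩
  obtain ⟨V, hV⟩ : ∃ V, V = volume.real (ball (0 : Plane) 1) := ⟨_, rfl⟩
  have hV0 : 0 < V := hV ▸ ENNReal.toReal_pos (measure_ball_pos _ _ (by norm_num)).ne'
    measure_ball_lt_top.ne
  obtain ⟨δ, hδ⟩ : ∃ δ, δ = c / V := ⟨_, rfl⟩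
  have hc0 : 0 < c := hcd ▸ hc
  have hδ0 : 0 < δ := hδ ▸ div_pos hc0 hV0
  obtain ⟨K, hK⟩ : ∃ K, K = 3 * (B ^ 2 + 1) / δ := ⟨_, rfl⟩
  have hK0 : 0 ≤ K := by rw [hK]; positivity
  refine ⟨K / c, by positivity, fun u w hu hw hg hs b => ?_⟩
  have : IsFiniteMeasure ((volume : Measure Plane).restrict (ball 0 1)) :=
    ⟨by simp⟩
  have hsq : ∀ {f g : Plane → ℝ}, AEStronglyMeasurable f (volume.restrict (ball (0 : Plane) 1)) →
      IntegrableOn g (ball 0 1) → (∀ x, f x ^ 2 ≤ g x) →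
      MemLp f 2 (volume.restrict (ball (0 : Plane) 1)) := fun {f g} hf hg hfg => by
    rw [memLp_two_iff_integrable_sq hf]
    refine Integrable.mono' hg (hf.pow 2) (.of_forall fun x => ?_)
    rw [Real.norm_of_nonneg (sq_nonneg _)]; exact hfg x
  have hsm : ∀ i, AEStronglyMeasurable (shear u w i) (volume.restrict (ball (0 : Plane) 1)) :=
    fun i => ((hu i).continuousOn.aestronglyMeasurable measurableSet_ball).add
      (measurable_pd i w).aestronglyMeasurable
  have hpu : ∀ i j, IntegrableOn (pd j (u i)) (ball 0 1) := fun i j =>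
    (hsq (measurable_pd _ _).aestronglyMeasurable hg (pd_sq_le_gradSq u i j)).integrable
      one_le_two
  have hsi : ∀ i, IntegrableOn (shear u w i) (ball 0 1) := fun i => by
    refine (hsq (hsm i) hs fun x => ?_).integrable one_le_two
    fin_cases i
    · exact le_add_of_nonneg_right (sq_nonneg _)
    · exact le_add_of_nonneg_left (sq_nonneg _)
  have hr2 : MemLp (fun x => rot u x - b) 2 (volume.restrict (ball (0 : Plane) 1)) :=
    (hsq (measurable_rot u).aestronglyMeasurable hg (rot_sq_le_gradSq u)).sub (memLp_const b)
  have hr : IntegrableOn (fun x => rot u x - b) (ball 0 1) := hr2.integrable one_le_two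
  have key := integral_shear_mul_curl isOpen_ball hu hw hη η.hasCompactSupport hηU hpu hsi
  have hpη : ∀ j, Continuous (pd j η) := fun j =>
    (hη.fderiv_right (m := 1) (by norm_num)).continuous.clm_apply continuous_const
  have hpc : ∀ j, HasCompactSupport (pd j η) := fun j => η.hasCompactSupport.fderiv_apply ℝ _
  have hpU : ∀ j, tsupport (pd j η) ⊆ ball 0 1 := fun j =>
    (tsupport_fderiv_apply_subset ℝ _).trans hηU
  have j1 : Integrable fun x => shear u w 0 x * pd 1 η x - shear u w 1 x * pd 0 η x :=
    (integrable_mul_of_integrableOn (hsi 0) (hpη 1) (hpc 1) (hpU 1)).sub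
      (integrable_mul_of_integrableOn (hsi 1) (hpη 0) (hpc 0) (hpU 0))
  have j2 : Integrable fun x => 2 * ((rot u x - b) * η x) :=
    (integrable_mul_of_integrableOn hr hη.continuous η.hasCompactSupport hηU).const_mul 2
  have j3 : Integrable fun x => 2 * b * η x :=
    (hη.continuous.integrable_of_hasCompactSupport η.hasCompactSupport).const_mul _
  have e1 : ∫ x, (shear u w 0 x * pd 1 η x - shear u w 1 x * pd 0 η x -
      2 * ((rot u x - b) * η x)) = 2 * b * c := by
    rw [integral_sub j1 j2, key, hcd, ← integral_const_mul]
    have : ∫ x, 2 * (rot u x * η x) = ∫ x, (2 * ((rot u x - b) * η x) + 2 * b * η x) :=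
      integral_congr_ae (.of_forall fun x => by ring)
    rw [this, integral_add j2 j3]; ring
  have e2 : ∫ x, b * (shear u w 0 x * pd 1 η x - shear u w 1 x * pd 0 η x -
      2 * ((rot u x - b) * η x)) = ∫ x in ball 0 1, b * (shear u w 0 x * pd 1 η x -
      shear u w 1 x * pd 0 η x - 2 * ((rot u x - b) * η x)) := by
    refine (setIntegral_eq_integral_of_forall_compl_eq_zero fun x hx => ?_).symm
    have z1 : ∀ j, pd j η x = 0 := fun j => image_eq_zero_of_notMem_tsupport fun h => hx (hpU j h)
    have z2 : η x = 0 := image_eq_zero_of_notMem_tsupport fun h => hx (hηU h)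
    simp [z1, z2]
  have m1 : IntegrableOn (fun x => δ * b ^ 2) (ball (0 : Plane) 1) := integrable_const _
  have m2 : IntegrableOn (fun x => (rot u x - b) ^ 2) (ball 0 1) := hr2.integrable_sq
  have e3 : ∫ x in ball 0 1, b * (shear u w 0 x * pd 1 η x -
      shear u w 1 x * pd 0 η x - 2 * ((rot u x - b) * η x)) ≤
      ∫ x in ball 0 1, (δ * b ^ 2 + K * (shear u w 0 x ^ 2 + shear u w 1 x ^ 2 +
        (rot u x - b) ^ 2)) := by
    refine integral_mono ((j1.sub j2).const_mul b).integrableOn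
      (m1.add ((hs.add m2).const_mul K)) fun x => ?_
    rw [hK]
    exact young_shear hδ0 (hp x 1) (hp x 0) (hη1 x)
  have e4 := integral_add m1 ((hs.add m2).const_mul K)
  have e5 := integral_add hs m2
  simp only [Pi.add_apply] at e4
  rw [← e2, integral_const_mul, e1, e4, integral_const_mul K, e5] at e3
  have e6 : ∫ x in ball (0 : Plane) 1, δ * b ^ 2 = c * b ^ 2 := by
    rw [setIntegral_const, ← hV, hδ, smul_eq_mul]; field_simp
  rw [e6] at e3
  rw [div_mul_eq_mul_div, le_div_iff₀ hc0]
  nlinarith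

lemma setLIntegral_ball_scale (G : Plane → ENNReal) (z : Plane) {r : ℝ} (hr : 0 < r) (s : ℝ) :
    ∫⁻ x in ball 0 s, G (z + r • x) =
      ENNReal.ofReal (r ^ 2)⁻¹ * ∫⁻ y in ball z (r * s), G y := by
  have h1 := setLIntegral_ball_comp_add_left G z 0 (r * s)
  rw [add_zero] at h1
  rw [← h1, ← lintegral_indicator measurableSet_ball, ← lintegral_indicator measurableSet_ball]
  have h2 := lintegral_map_equiv (μ := (volume : Measure Plane))
    ((ball (0 : Plane) (r * s)).indicator fun h => G (z + h))
    (Homeomorph.smulOfNeZero r hr.ne' : Plane ≃ₜ Plane).toMeasurableEquiv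
  have h3 : Measure.map (Homeomorph.smulOfNeZero r hr.ne' : Plane ≃ₜ Plane).toMeasurableEquiv
      volume = ENNReal.ofReal (r ^ 2)⁻¹ • (volume : Measure Plane) := by
    have := Measure.map_addHaar_smul (volume : Measure Plane) hr.ne'
    rw [finrank_euclideanSpace_fin, abs_of_nonneg (by positivity)] at this
    exact this
  rw [h3, lintegral_smul_measure, smul_eq_mul] at h2
  rw [h2]
  refine lintegral_congr fun x => ?_
  have hm : x ∈ ball (0 : Plane) s ↔ r • x ∈ ball (0 : Plane) (r * s) := by
    rw [mem_ball_zero_iff, mem_ball_zero_iff, norm_smul, Real.norm_of_nonneg hr.le,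
      mul_lt_mul_iff_right₀ hr]
  change _ = (ball (0 : Plane) (r * s)).indicator (fun h => G (z + h)) (r • x)
  by_cases hx : x ∈ ball (0 : Plane) s
  · rw [Set.indicator_of_mem hx, Set.indicator_of_mem (hm.1 hx)]
  · rw [Set.indicator_of_notMem hx, Set.indicator_of_notMem (fun h => hx (hm.2 h))]

lemma pd_scale (f : Plane → ℝ) (c r : ℝ) (z x : Plane) (j : Fin 2) :
    pd j (fun y => c * f (z + r • y)) x = c * (r * pd j f (z + r • x)) := by
  have h1 : (fun y => c * f (z + r • y)) = c • fun y => (fun h => f (z + h)) (r • y) := rfl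
  rw [pd, h1, fderiv_const_smul_field, Pi.smul_apply,
    fderiv_comp_smul (f := fun h => f (z + h)), fderiv_comp_add_left]
  simp [pd]

lemma differentiableOn_scale {f : Plane → ℝ} {z : Plane} {r s : ℝ} (hr : 0 < r)
    (hf : DifferentiableOn ℝ f (ball z (r * s))) (c : ℝ) :
    DifferentiableOn ℝ (fun y => c * f (z + r • y)) (ball 0 s) := by
  refine DifferentiableOn.const_mul (hf.comp (by fun_prop) fun x hx => ?_) c
  rw [mem_ball_zero_iff] at hx
  rw [mem_ball_iff_norm, add_sub_cancel_left, norm_smul, Real.norm_of_nonneg hr.le]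
  exact mul_lt_mul_of_pos_left hx hr

lemma pd_rescale (f : Plane → ℝ) {r : ℝ} (hr : 0 < r) (z x : Plane) (j : Fin 2) :
    pd j (fun y => r⁻¹ * f (z + r • y)) x = pd j f (z + r • x) := by
  rw [pd_scale, inv_mul_cancel_left₀ hr.ne']

lemma setLIntegral_ball_eq_scale (G : Plane → ENNReal) (z : Plane) {r : ℝ} (hr : 0 < r) (s : ℝ) :
    ∫⁻ y in ball z (r * s), G y = ENNReal.ofReal (r ^ 2) * ∫⁻ x in ball 0 s, G (z + r • x) := by
  rw [setLIntegral_ball_scale G z hr s, ← mul_assoc, ← ENNReal.ofReal_mul (by positivity),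
    mul_inv_cancel₀ (by positivity), ENNReal.ofReal_one, one_mul]

lemma exists_rot_approx : ∃ C : NNReal, ∀ (z : Plane) (r : ℝ), 0 < r → ∀ u : Fin 2 → Plane → ℝ,
    (∀ i, DifferentiableOn ℝ (u i) (ball z (2 * r))) →
    ∫⁻ x in ball z (2 * r), ENNReal.ofReal (gradSq u x) < ⊤ →
    ∃ b : ℝ, ∫⁻ x in ball z r, ENNReal.ofReal ((rot u x - b) ^ 2) ≤
      C * ∫⁻ x in ball z (2 * r), ENNReal.ofReal (strainSq u x) := by
  obtain ⟨C, hC⟩ := exists_rot_approx_unit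
  refine ⟨C, fun z r hr u hu hg => ?_⟩
  rw [mul_comm 2 r] at hu hg ⊢
  have hp := fun (i j : Fin 2) x => pd_rescale (u i) hr z x j
  have eg : ∀ x, gradSq (fun i y => r⁻¹ * u i (z + r • y)) x = gradSq u (z + r • x) := fun x => by
    simp only [gradSq, hp]
  have es : ∀ x, strainSq (fun i y => r⁻¹ * u i (z + r • y)) x = strainSq u (z + r • x) :=
    fun x => by simp only [strainSq, hp]
  have er : ∀ x, rot (fun i y => r⁻¹ * u i (z + r • y)) x = rot u (z + r • x) := fun x => by
    simp only [rot, hp]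
  obtain ⟨b, hb⟩ := hC (fun i y => r⁻¹ * u i (z + r • y))
    (fun i => differentiableOn_scale hr (hu i) _) (by
      simp_rw [eg]
      rw [setLIntegral_ball_scale (fun y => ENNReal.ofReal (gradSq u y)) z hr]
      exact ENNReal.mul_lt_top ENNReal.ofReal_lt_top hg)
  refine ⟨b, ?_⟩
  simp_rw [es, er] at hb
  have h1 := setLIntegral_ball_eq_scale (fun y => ENNReal.ofReal ((rot u y - b) ^ 2)) z hr 1
  rw [mul_one] at h1
  rw [h1, setLIntegral_ball_eq_scale (fun y => ENNReal.ofReal (strainSq u y)) z hr 2,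
    mul_left_comm]
  gcongr

/-- A constant rotation is controlled by its distance to gradients. -/
lemma exists_rotation_bound : ∃ C : NNReal, ∀ (z : Plane) (r : ℝ), 0 < r →
    ∀ (u : Fin 2 → Plane → ℝ) (w : Plane → ℝ),
    (∀ i, DifferentiableOn ℝ (u i) (ball z r)) → DifferentiableOn ℝ w (ball z r) →
    ∫⁻ x in ball z r, ENNReal.ofReal (gradSq u x) < ⊤ →
    ∫⁻ x in ball z r, ENNReal.ofReal (shear u w 0 x ^ 2 + shear u w 1 x ^ 2) < ⊤ →
    ∀ b : ℝ, ENNReal.ofReal (b ^ 2) ≤ C * (ENNReal.ofReal (r ^ 4)⁻¹ *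
      (∫⁻ x in ball z r, ENNReal.ofReal (shear u w 0 x ^ 2 + shear u w 1 x ^ 2)) +
      ENNReal.ofReal (r ^ 2)⁻¹ * ∫⁻ x in ball z r, ENNReal.ofReal ((rot u x - b) ^ 2)) := by
  obtain ⟨C, hC0, hC⟩ := exists_rotation_bound_unit
  refine ⟨C.toNNReal, fun z r hr u w hu hw hg hs b => ?_⟩
  obtain ⟨v, hv⟩ : ∃ v : Fin 2 → Plane → ℝ, v = fun i y => r⁻¹ * u i (z + r • y) := ⟨_, rfl⟩
  obtain ⟨k, hk⟩ : ∃ k : Plane → ℝ, k = fun y => (r ^ 2)⁻¹ * w (z + r • y) := ⟨_, rfl⟩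
  have hp : ∀ i j x, pd j (v i) x = pd j (u i) (z + r • x) := fun i j x => by
    rw [hv]; exact pd_rescale (u i) hr z x j
  have eg : ∀ x, gradSq v x = gradSq u (z + r • x) := fun x => by simp only [gradSq, hp]
  have er : ∀ x, rot v x = rot u (z + r • x) := fun x => by simp only [rot, hp]
  have esh : ∀ i x, shear v k i x = r⁻¹ * shear u w i (z + r • x) := fun i x => by
    rw [shear, shear, hk, pd_scale, hv]
    field_simp
  have ess : ∀ x, ENNReal.ofReal (shear v k 0 x ^ 2 + shear v k 1 x ^ 2) =
      ENNReal.ofReal (r ^ 2)⁻¹ * ENNReal.ofReal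
        (shear u w 0 (z + r • x) ^ 2 + shear u w 1 (z + r • x) ^ 2) := fun x => by
    rw [← ENNReal.ofReal_mul (by positivity), esh, esh]
    congr 1; field_simp
  have lg : ∫⁻ x in ball 0 1, ENNReal.ofReal (gradSq v x) < ⊤ := by
    simp_rw [eg]
    rw [setLIntegral_ball_scale (fun y => ENNReal.ofReal (gradSq u y)) z hr, mul_one]
    exact ENNReal.mul_lt_top ENNReal.ofReal_lt_top hg
  have ls : ∫⁻ x in ball 0 1, ENNReal.ofReal (shear v k 0 x ^ 2 + shear v k 1 x ^ 2) =
      ENNReal.ofReal (r ^ 4)⁻¹ * ∫⁻ x in ball z r,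
        ENNReal.ofReal (shear u w 0 x ^ 2 + shear u w 1 x ^ 2) := by
    simp_rw [ess]
    rw [lintegral_const_mul' _ _ ENNReal.ofReal_ne_top, setLIntegral_ball_scale
      (fun y => ENNReal.ofReal (shear u w 0 y ^ 2 + shear u w 1 y ^ 2)) z hr, mul_one,
      ← mul_assoc, ← ENNReal.ofReal_mul (by positivity)]
    congr 3; field_simp
  have lr : ∫⁻ x in ball 0 1, ENNReal.ofReal ((rot v x - b) ^ 2) =
      ENNReal.ofReal (r ^ 2)⁻¹ * ∫⁻ x in ball z r, ENNReal.ofReal ((rot u x - b) ^ 2) := by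
    simp_rw [er]
    rw [setLIntegral_ball_scale (fun y => ENNReal.ofReal ((rot u y - b) ^ 2)) z hr, mul_one]
  have hvd : ∀ i, DifferentiableOn ℝ (v i) (ball 0 1) := fun i => by
    rw [hv]; exact differentiableOn_scale hr (by rw [mul_one]; exact hu i) _
  have hkd : DifferentiableOn ℝ k (ball 0 1) := by
    rw [hk]; exact differentiableOn_scale hr (by rw [mul_one]; exact hw) _
  have hgi : IntegrableOn (gradSq v) (ball 0 1) := by
    refine ⟨(measurable_gradSq v).aestronglyMeasurable, ?_⟩
    rwa [hasFiniteIntegral_iff_ofReal (.of_forall (gradSq_nonneg v))]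
  have hsm : ∀ i, AEStronglyMeasurable (shear v k i) (volume.restrict (ball (0 : Plane) 1)) :=
    fun i => ((hvd i).continuousOn.aestronglyMeasurable measurableSet_ball).add
      (measurable_pd i k).aestronglyMeasurable
  have hsn : ∀ x, 0 ≤ shear v k 0 x ^ 2 + shear v k 1 x ^ 2 := fun x => by positivity
  have hsi : IntegrableOn (fun x => shear v k 0 x ^ 2 + shear v k 1 x ^ 2) (ball 0 1) := by
    refine ⟨((hsm 0).pow 2).add ((hsm 1).pow 2), ?_⟩
    rw [hasFiniteIntegral_iff_ofReal (.of_forall hsn), ls]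
    exact ENNReal.mul_lt_top ENNReal.ofReal_lt_top hs
  have hri : IntegrableOn (fun x => (rot v x - b) ^ 2) (ball 0 1) := by
    refine Integrable.mono' ((hgi.const_mul 2).add (integrableOn_const (C := 2 * b ^ 2)
      measure_ball_lt_top.ne)) (by fun_prop) (.of_forall fun x => ?_)
    rw [Real.norm_of_nonneg (sq_nonneg _), Pi.add_apply]
    nlinarith [sq_nonneg (rot v x + b), rot_sq_le_gradSq v x]
  have main := ENNReal.ofReal_le_ofReal (hC v k hvd hkd hgi hsi b)
  rw [ENNReal.ofReal_mul hC0, ENNReal.ofReal_add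
    (integral_nonneg hsn) (integral_nonneg fun x => sq_nonneg _),
    ofReal_integral_eq_lintegral_ofReal hsi (.of_forall hsn),
    ofReal_integral_eq_lintegral_ofReal hri (.of_forall fun x => sq_nonneg _), ls, lr] at main
  exact main

open Classical in
/-- Indicator of `dist x z < c * t z`, weighted by `t z ^ (-2)`. -/
noncomputable def whitneyKernel (t : Plane → ℝ) (c : ℝ) (x z : Plane) : ENNReal :=
  if dist x z < c * t z then ENNReal.ofReal (t z ^ 2)⁻¹ else 0

lemma whitneyKernel_of_lt {t : Plane → ℝ} {c : ℝ} {x z : Plane} (h : dist x z < c * t z) :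
    whitneyKernel t c x z = ENNReal.ofReal (t z ^ 2)⁻¹ := if_pos h

lemma whitneyKernel_of_not_lt {t : Plane → ℝ} {c : ℝ} {x z : Plane} (h : ¬ dist x z < c * t z) :
    whitneyKernel t c x z = 0 := if_neg h

lemma measurable_whitneyKernel {t : Plane → ℝ} (ht : Continuous t) (c : ℝ) :
    Measurable fun p : Plane × Plane => whitneyKernel t c p.1 p.2 := by
  have h1 : MeasurableSet {p : Plane × Plane | dist p.1 p.2 < c * t p.2} :=
    (isOpen_lt (continuous_fst.dist continuous_snd)
      (continuous_const.mul (ht.comp continuous_snd))).measurableSet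
  have h2 : Measurable fun p : Plane × Plane => ENNReal.ofReal (t p.2 ^ 2)⁻¹ :=
    ((ht.measurable.comp measurable_snd).pow_const 2).inv.ennreal_ofReal
  exact Measurable.ite h1 h2 measurable_const

lemma mul_setLIntegral_eq_lintegral_whitneyKernel (t : Plane → ℝ) (c : ℝ)
    (H : Plane → ENNReal) (z : Plane) :
    ENNReal.ofReal (t z ^ 2)⁻¹ * ∫⁻ x in ball z (c * t z), H x =
      ∫⁻ x, whitneyKernel t c x z * H x := by
  rw [← lintegral_const_mul' _ _ ENNReal.ofReal_ne_top, ← lintegral_indicator measurableSet_ball]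
  refine lintegral_congr fun x => ?_
  by_cases hx : dist x z < c * t z
  · rw [Set.indicator_of_mem (mem_ball.2 hx), whitneyKernel_of_lt hx]
  · rw [Set.indicator_of_notMem (fun h => hx (mem_ball.1 h)), whitneyKernel_of_not_lt hx, zero_mul]

lemma lintegral_whitneyKernel_swap {t : Plane → ℝ} (ht : Continuous t) (c : ℝ)
    {H : Plane → ENNReal} (hH : Measurable H) (Z : Set Plane) :
    ∫⁻ z in Z, ENNReal.ofReal (t z ^ 2)⁻¹ * ∫⁻ x in ball z (c * t z), H x =
      ∫⁻ x, H x * ∫⁻ z in Z, whitneyKernel t c x z := by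
  simp_rw [mul_setLIntegral_eq_lintegral_whitneyKernel]
  have hk := measurable_whitneyKernel ht c
  obtain ⟨k, hkk⟩ : ∃ k, k = whitneyKernel t c := ⟨_, rfl⟩
  rw [← hkk] at hk ⊢
  rw [lintegral_lintegral_swap]
  · refine lintegral_congr fun x => ?_
    have hkx : Measurable fun z => k x z := hk.comp measurable_prodMk_left
    rw [lintegral_mul_const _ hkx, mul_comm]
  · exact ((hk.comp measurable_swap).mul (hH.comp measurable_snd)).aemeasurable

lemma volume_ball_eq (z : Plane) {r : ℝ} (hr : 0 ≤ r) :
    volume (ball z r) = ENNReal.ofReal (r ^ 2) * volume (ball (0 : Plane) 1) := by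
  have := Measure.addHaar_ball (volume : Measure Plane) z hr
  rwa [finrank_euclideanSpace_fin] at this

/-- Local estimates on Whitney-type balls can be summed. -/
lemma setLIntegral_le_of_whitney {t : Plane → ℝ} {K ρ : ℝ} (hρ : 0 < ρ) (hKρ : K * ρ ≤ 1 / 4)
    (ht : ∀ x y, |t x - t y| ≤ K * dist x y) (htc : Continuous t)
    {S Z R : Set Plane} (hSm : MeasurableSet S) (hZm : MeasurableSet Z) (hRm : MeasurableSet R)
    (hS : ∀ x ∈ S, 0 < t x) (hZ : ∀ z ∈ Z, 0 < t z)
    (hSZ : ∀ x ∈ S, ∀ z, dist x z < ρ * t x / 4 → z ∈ Z)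
    (hZR : ∀ z ∈ Z, ∀ x, dist x z < 2 * ρ * t z → x ∈ R)
    {F G : Plane → ENNReal} (hF : Measurable F) (hG : Measurable G) {C : ENNReal} (hC : C ≠ ⊤)
    (h : ∀ z ∈ Z, ∫⁻ x in ball z (ρ / 2 * t z), F x ≤ C * ∫⁻ x in ball z (2 * ρ * t z), G x) :
    ∫⁻ x in S, F x ≤ ENNReal.ofReal 2304 * C * ∫⁻ x in R, G x := by
  have htz : ∀ {x z s : _}, 0 < s → dist x z < ρ * s → |t x - t z| ≤ s / 4 := fun {x z s} hs hd => by
    rcases le_or_gt K 0 with hK | hK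
    · exact (ht x z).trans ((mul_nonpos_of_nonpos_of_nonneg hK dist_nonneg).trans (by positivity))
    · refine (ht x z).trans ?_
      have := mul_le_mul_of_nonneg_left hd.le hK.le
      nlinarith
  obtain ⟨V, hV⟩ : ∃ V, V = volume (ball (0 : Plane) 1) := ⟨_, rfl⟩
  have hV0 : V ≠ 0 := hV ▸ (measure_ball_pos _ _ (by norm_num)).ne'
  have hVt : V ≠ ⊤ := hV ▸ measure_ball_lt_top.ne
  have low : ∀ x ∈ S, ENNReal.ofReal (ρ ^ 2 / 64) * V ≤
      ∫⁻ z in Z, whitneyKernel t (ρ / 2) x z := fun x hx => by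
    have hx0 := hS x hx
    calc ENNReal.ofReal (ρ ^ 2 / 64) * V
        = ∫⁻ z in ball x (ρ * t x / 4), ENNReal.ofReal (4 * t x ^ 2)⁻¹ := by
          rw [setLIntegral_const, volume_ball_eq x (by positivity), ← hV, ← mul_assoc,
            ← ENNReal.ofReal_mul (by positivity)]
          congr 2; field_simp; norm_num
      _ ≤ ∫⁻ z in ball x (ρ * t x / 4), whitneyKernel t (ρ / 2) x z := by
          refine setLIntegral_mono' measurableSet_ball fun z hz => ?_
          rw [mem_ball, dist_comm] at hz
          have h1 := abs_le.1 (htz (x := x) (z := z) (s := t x / 4) (by positivity) (by linarith))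
          have hz0 : 0 < t z := by linarith [h1.2]
          rw [whitneyKernel_of_lt (by nlinarith [h1.2])]
          refine ENNReal.ofReal_le_ofReal ?_
          gcongr
          nlinarith [h1.1]
      _ ≤ _ := by
          refine lintegral_mono_set fun z hz => hSZ x hx z ?_
          rwa [mem_ball, dist_comm] at hz
  have up : ∀ x, ∫⁻ z in Z, whitneyKernel t (2 * ρ) x z ≤
      R.indicator (fun _ => ENNReal.ofReal (36 * ρ ^ 2) * V) x := fun x => by
    have hh : ∀ z ∈ Z, dist x z < 2 * ρ * t z → |t x - t z| ≤ t z / 2 := fun z hz hd => by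
      have := htz (x := x) (z := z) (s := 2 * t z) (by linarith [hZ z hz]) (by linarith)
      linarith
    by_cases hx : x ∈ R
    · rw [Set.indicator_of_mem hx]
      by_cases hx0 : 0 < t x
      · calc ∫⁻ z in Z, whitneyKernel t (2 * ρ) x z
            ≤ ∫⁻ z in Z, (ball x (4 * ρ * t x)).indicator
              (fun _ => ENNReal.ofReal (9 / 4 * (t x ^ 2)⁻¹)) z := by
              refine setLIntegral_mono' hZm fun z hz => ?_
              by_cases hd : dist x z < 2 * ρ * t z
              · have h1 := abs_le.1 (hh z hz hd)
                have hz0 := hZ z hz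
                have hzb : z ∈ ball x (4 * ρ * t x) := by
                  rw [mem_ball, dist_comm]
                  refine hd.trans_le ?_
                  nlinarith [h1.1]
                rw [whitneyKernel_of_lt hd, Set.indicator_of_mem hzb]
                refine ENNReal.ofReal_le_ofReal ?_
                rw [← div_eq_mul_inv, inv_eq_one_div, div_le_div_iff₀ (by positivity) (by positivity)]
                nlinarith [h1.2]
              · rw [whitneyKernel_of_not_lt hd]; exact zero_le
          _ ≤ ∫⁻ z, (ball x (4 * ρ * t x)).indicator
              (fun _ => ENNReal.ofReal (9 / 4 * (t x ^ 2)⁻¹)) z := setLIntegral_le_lintegral _ _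
          _ = ENNReal.ofReal (36 * ρ ^ 2) * V := by
              rw [lintegral_indicator measurableSet_ball, setLIntegral_const,
                volume_ball_eq x (by positivity), ← hV, ← mul_assoc,
                ← ENNReal.ofReal_mul (by positivity)]
              congr 2; field_simp; norm_num
      · rw [setLIntegral_congr_fun (g := fun _ => 0) hZm fun z hz => whitneyKernel_of_not_lt
          fun hd => hx0 (by linarith [abs_le.1 (hh z hz hd), hZ z hz])]
        simp
    · rw [Set.indicator_of_notMem hx, setLIntegral_congr_fun (g := fun _ => 0) hZm fun z hz =>
        whitneyKernel_of_not_lt fun hd => hx (hZR z hz x hd)]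
      simp
  have hc0 : ENNReal.ofReal (ρ ^ 2 / 64) * V ≠ 0 :=
    mul_ne_zero (by rw [Ne, ENNReal.ofReal_eq_zero, not_le]; positivity) hV0
  have hct : ENNReal.ofReal (ρ ^ 2 / 64) * V ≠ ⊤ := ENNReal.mul_ne_top ENNReal.ofReal_ne_top hVt
  have hct' : ENNReal.ofReal (36 * ρ ^ 2) * V ≠ ⊤ :=
    ENNReal.mul_ne_top ENNReal.ofReal_ne_top hVt
  rw [← ENNReal.mul_le_mul_iff_right hc0 hct]
  calc ENNReal.ofReal (ρ ^ 2 / 64) * V * ∫⁻ x in S, F x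
      = ∫⁻ x in S, F x * (ENNReal.ofReal (ρ ^ 2 / 64) * V) := by
        rw [lintegral_mul_const' _ _ hct, mul_comm]
    _ ≤ ∫⁻ x in S, F x * ∫⁻ z in Z, whitneyKernel t (ρ / 2) x z :=
        setLIntegral_mono' hSm fun x hx => by gcongr; exact low x hx
    _ ≤ ∫⁻ x, F x * ∫⁻ z in Z, whitneyKernel t (ρ / 2) x z := setLIntegral_le_lintegral _ _
    _ = ∫⁻ z in Z, ENNReal.ofReal (t z ^ 2)⁻¹ * ∫⁻ x in ball z (ρ / 2 * t z), F x :=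
        (lintegral_whitneyKernel_swap htc _ hF Z).symm
    _ ≤ ∫⁻ z in Z, C * (ENNReal.ofReal (t z ^ 2)⁻¹ * ∫⁻ x in ball z (2 * ρ * t z), G x) := by
        refine setLIntegral_mono' hZm fun z hz => ?_
        rw [mul_left_comm]
        gcongr
        exact h z hz
    _ = C * ∫⁻ x, G x * ∫⁻ z in Z, whitneyKernel t (2 * ρ) x z := by
        rw [lintegral_const_mul' _ _ hC, lintegral_whitneyKernel_swap htc _ hG Z]
    _ ≤ C * ∫⁻ x, G x * R.indicator (fun _ => ENNReal.ofReal (36 * ρ ^ 2) * V) x := by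
        gcongr with x; exact up x
    _ = C * ∫⁻ x in R, G x * (ENNReal.ofReal (36 * ρ ^ 2) * V) := by
        rw [← lintegral_indicator hRm]
        congr 1
        refine lintegral_congr fun x => ?_
        by_cases hx : x ∈ R <;> simp [hx]
    _ = C * ((∫⁻ x in R, G x) * (ENNReal.ofReal (36 * ρ ^ 2) * V)) := by
        rw [lintegral_mul_const' _ _ hct']
    _ = _ := by
        have : ENNReal.ofReal (36 * ρ ^ 2) = ENNReal.ofReal (ρ ^ 2 / 64) * ENNReal.ofReal 2304 := by
          rw [← ENNReal.ofReal_mul (by positivity)]; congr 1; ring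
        rw [this]; ring

/-- Coordinates in which a Lipschitz graph becomes `t = 0`, `ν` being the vertical direction. -/
structure LipschitzChart (K : ℝ) (σ t : Plane → ℝ) (ν : Plane) : Prop where
  one_le : 1 ≤ K
  abs_sigma_sub_le : ∀ x y, |σ x - σ y| ≤ dist x y
  abs_height_sub_le : ∀ x y, |t x - t y| ≤ K * dist x y
  dist_le : ∀ x y, dist x y ≤ K * |σ x - σ y| + |t x - t y|
  norm_dir : ‖ν‖ = 1
  sigma_add_smul : ∀ (x : Plane) (s : ℝ), σ (x + s • ν) = σ x
  height_add_smul : ∀ (x : Plane) (s : ℝ), t (x + s • ν) = t x + s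
  lintegral_comp_stretch : ∀ κ : ℝ, 0 < κ → ∀ g : Plane → ENNReal, Measurable g →
    ∫⁻ x, g (x + (κ * t x) • ν) = ENNReal.ofReal (1 + κ)⁻¹ * ∫⁻ x, g x

lemma lintegral_comp_mul_add {lam : ℝ} (hl : 0 < lam) (c : ℝ) {g : ℝ → ENNReal}
    (hg : Measurable g) :
    ∫⁻ q, g (lam * q + c) = ENNReal.ofReal lam⁻¹ * ∫⁻ q, g q := by
  have h1 : ∫⁻ q, g (lam * q + c) = ∫⁻ q, g (q + c) ∂(Measure.map (lam * ·) volume) := by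
    rw [lintegral_map (by fun_prop) (by fun_prop)]
  rw [h1, Real.map_volume_mul_left hl.ne', lintegral_smul_measure, lintegral_add_right_eq_self,
    abs_of_pos (inv_pos.2 hl), smul_eq_mul]

lemma measurePreserving_coords :
    MeasurePreserving fun x : Plane => (x 0, x 1) := by
  have h1 := PiLp.volume_preserving_ofLp (Fin 2)
  exact (volume_preserving_finTwoArrow ℝ).comp h1

lemma exists_lipschitzChart (f : Plane ≃ᵢ Plane) {ψ : ℝ → ℝ} {M : ℝ} (hM : 0 ≤ M)
    (hψ : LipschitzWith M.toNNReal ψ) :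
    ∃ ν, LipschitzChart (1 + M) (fun x => f x 0) (fun x => f x 1 - ψ (f x 0)) ν := by
  obtain ⟨A, hA⟩ : ∃ A, A = f.toRealAffineIsometryEquiv := ⟨_, rfl⟩
  have hfA : ∀ x, f x = A x := fun x => by rw [hA]; rfl
  obtain ⟨L, hL⟩ : ∃ L, L = A.linearIsometryEquiv := ⟨_, rfl⟩
  have hadd : ∀ x v, f (x + v) = f x + L v := fun x v => by
    rw [hfA, hfA, add_comm x v, ← vadd_eq_add, A.map_vadd, ← hL, vadd_eq_add, add_comm]
  obtain ⟨ν, hν⟩ : ∃ ν, ν = L.symm (EuclideanSpace.single 1 1) := ⟨_, rfl⟩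
  have hLν : L ν = EuclideanSpace.single 1 1 := by rw [hν, L.apply_symm_apply]
  have hf0 : ∀ x (s : ℝ), f (x + s • ν) 0 = f x 0 := fun x s => by
    rw [hadd, map_smul, hLν]; simp
  have hf1 : ∀ x (s : ℝ), f (x + s • ν) 1 = f x 1 + s := fun x s => by
    rw [hadd, map_smul, hLν]; simp
  have hψ' : ∀ a b, |ψ a - ψ b| ≤ M * |a - b| := fun a b => by
    have := hψ.dist_le_mul a b
    rwa [Real.dist_eq, Real.dist_eq, Real.coe_toNNReal M hM] at this
  have hsq : ∀ x y, dist x y ^ 2 = (f x 0 - f y 0) ^ 2 + (f x 1 - f y 1) ^ 2 := fun x y => by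
    rw [← f.isometry.dist_eq, EuclideanSpace.dist_eq, Real.sq_sqrt (by positivity),
      Fin.sum_univ_two, Real.dist_eq, Real.dist_eq, sq_abs, sq_abs]
  have hle0 : ∀ x y, |f x 0 - f y 0| ≤ dist x y := fun x y =>
    abs_le_of_sq_le_sq (by rw [hsq]; nlinarith [sq_nonneg (f x 1 - f y 1)]) dist_nonneg
  have hle1 : ∀ x y, |f x 1 - f y 1| ≤ dist x y := fun x y =>
    abs_le_of_sq_le_sq (by rw [hsq]; nlinarith [sq_nonneg (f x 0 - f y 0)]) dist_nonneg
  refine ⟨ν, ⟨by linarith, hle0, fun x y => ?_, fun x y => ?_, ?_, hf0, fun x s => ?_, ?_⟩⟩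
  · have e : f x 1 - ψ (f x 0) - (f y 1 - ψ (f y 0)) =
        (f x 1 - f y 1) - (ψ (f x 0) - ψ (f y 0)) := by ring
    rw [e]
    have h1 := abs_sub (f x 1 - f y 1) (ψ (f x 0) - ψ (f y 0))
    have h2 := hψ' (f x 0) (f y 0)
    have h3 := mul_le_mul_of_nonneg_left (hle0 x y) hM
    linarith [hle1 x y]
  · have h1 : dist x y ≤ |f x 0 - f y 0| + |f x 1 - f y 1| := by
      refine abs_le_of_sq_le_sq' ?_ (by positivity) |>.2
      rw [hsq, ← sq_abs (f x 0 - f y 0), ← sq_abs (f x 1 - f y 1)]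
      nlinarith [abs_nonneg (f x 0 - f y 0), abs_nonneg (f x 1 - f y 1)]
    have e : f x 1 - f y 1 = (f x 1 - ψ (f x 0) - (f y 1 - ψ (f y 0))) +
        (ψ (f x 0) - ψ (f y 0)) := by ring
    have h2 := abs_add_le (f x 1 - ψ (f x 0) - (f y 1 - ψ (f y 0))) (ψ (f x 0) - ψ (f y 0))
    rw [← e] at h2
    have h3 := hψ' (f x 0) (f y 0)
    linarith
  · rw [hν, L.symm.norm_map]; simp
  · rw [hf1, hf0]; ring
  · intro κ hκ g hg
    have hmp : MeasurePreserving f := by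
      have e : ⇑f = fun x => f 0 + L x := by
        funext x; rw [← hadd, zero_add]
      rw [e]
      exact (measurePreserving_add_left volume (f 0)).comp L.measurePreserving
    have hmp2 := measurePreserving_coords.comp hmp
    obtain ⟨G, hG⟩ : ∃ G : ℝ × ℝ → ENNReal,
        G = fun p => g (f.symm (!₂[p.1, p.2])) := ⟨_, rfl⟩
    have hGm : Measurable G := by
      rw [hG]
      refine hg.comp (f.symm.continuous.measurable.comp ?_)
      fun_prop
    have hGf : ∀ x, g x = G (f x 0, f x 1) := fun x => by
      rw [hG]
      congr 1
      rw [IsometryEquiv.eq_symm_apply]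
      ext i; fin_cases i <;> rfl
    have hψm : Measurable ψ := hψ.continuous.measurable
    have hl : ∀ H : ℝ × ℝ → ENNReal, Measurable H →
        ∫⁻ x, H (f x 0, f x 1) = ∫⁻ p, ∫⁻ q, H (p, q) := fun H hH => by
      have := hmp2.lintegral_comp hH
      rw [Measure.volume_eq_prod, lintegral_prod _ hH.aemeasurable] at this
      exact this
    have hm : Measurable fun p : ℝ × ℝ => G (p.1, (1 + κ) * p.2 + -(κ * ψ p.1)) :=
      hGm.comp (by fun_prop)
    have key := hl _ hm
    have e1 : ∀ x, g (x + (κ * (f x 1 - ψ (f x 0))) • ν) =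
        G (f x 0, (1 + κ) * f x 1 + -(κ * ψ (f x 0))) := fun x => by
      rw [hGf, hf0, hf1]
      congr 2; ring
    calc ∫⁻ x, g (x + (κ * (f x 1 - ψ (f x 0))) • ν)
        = ∫⁻ x, G (f x 0, (1 + κ) * f x 1 + -(κ * ψ (f x 0))) := lintegral_congr e1
      _ = ∫⁻ p, ∫⁻ q, G (p, (1 + κ) * q + -(κ * ψ p)) := key
      _ = ∫⁻ p, ENNReal.ofReal (1 + κ)⁻¹ * ∫⁻ q, G (p, q) := by
          refine lintegral_congr fun p => ?_
          exact lintegral_comp_mul_add (by linarith) _ (hGm.comp measurable_prodMk_left)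
      _ = ENNReal.ofReal (1 + κ)⁻¹ * ∫⁻ p, ∫⁻ q, G (p, q) :=
          lintegral_const_mul' _ _ ENNReal.ofReal_ne_top
      _ = _ := by
          rw [← hl _ hGm]
          simp_rw [hGf]

/-- The part of the strip `|σ| < a` of height between `0` and `T`. -/
def strip (σ t : Plane → ℝ) (a T : ℝ) : Set Plane := {x | |σ x| < a ∧ 0 < t x ∧ t x < T}

lemma LipschitzChart.continuous_height {K : ℝ} {σ t : Plane → ℝ} {ν : Plane}
    (h : LipschitzChart K σ t ν) : Continuous t := by
  refine (LipschitzWith.of_dist_le_mul (K := K.toNNReal) fun x y => ?_).continuous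
  rw [Real.coe_toNNReal K (by linarith [h.one_le]), Real.dist_eq]
  exact h.abs_height_sub_le x y

lemma LipschitzChart.continuous_sigma {K : ℝ} {σ t : Plane → ℝ} {ν : Plane}
    (h : LipschitzChart K σ t ν) : Continuous σ := by
  refine (LipschitzWith.of_dist_le_mul (K := 1) fun x y => ?_).continuous
  rw [Real.dist_eq, NNReal.coe_one, one_mul]
  exact h.abs_sigma_sub_le x y

lemma LipschitzChart.measurableSet_strip {K : ℝ} {σ t : Plane → ℝ} {ν : Plane}
    (h : LipschitzChart K σ t ν) (a T : ℝ) : MeasurableSet (strip σ t a T) := by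
  have h1 := h.continuous_height
  have h2 := h.continuous_sigma
  exact ((isOpen_lt h2.abs continuous_const).inter ((isOpen_lt continuous_const h1).inter
    (isOpen_lt h1 continuous_const))).measurableSet

lemma setLIntegral_sub_stretch_sq_le {D : NNReal}
    (hD : ∀ (z : Plane) (r : ℝ), 0 < r → ∀ u : Fin 2 → Plane → ℝ,
      (∀ i, DifferentiableOn ℝ (u i) (ball z (2 * r))) →
      ∫⁻ x in ball z (2 * r), ENNReal.ofReal (gradSq u x) < ⊤ →
      ∃ b : ℝ, ∫⁻ x in ball z r, ENNReal.ofReal ((rot u x - b) ^ 2) ≤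
        D * ∫⁻ x in ball z (2 * r), ENNReal.ofReal (strainSq u x))
    {K : ℝ} {σ t : Plane → ℝ} {ν : Plane} (h : LipschitzChart K σ t ν) {ρ : ℝ} (hρ : 0 < ρ)
    (hKρ : K * ρ ≤ 1 / 4) {z : Plane} (hz : 0 < t z) {u : Fin 2 → Plane → ℝ}
    (hu : ∀ i, DifferentiableOn ℝ (u i) (ball z (2 * ρ * t z)))
    (hg : ∫⁻ x in ball z (2 * ρ * t z), ENNReal.ofReal (gradSq u x) < ⊤) :
    ∫⁻ x in ball z (ρ / 2 * t z),
        ENNReal.ofReal ((rot u x - rot u (x + (ρ / 3 * t x) • ν)) ^ 2) ≤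
      4 * D * ∫⁻ x in ball z (2 * ρ * t z), ENNReal.ofReal (strainSq u x) := by
  have e : 2 * (ρ * t z) = 2 * ρ * t z := by ring
  obtain ⟨b, hb⟩ := hD z (ρ * t z) (by positivity) u (by rwa [e]) (by rwa [e])
  rw [e] at hb
  obtain ⟨H, hH⟩ : ∃ H : Plane → ENNReal,
      H = (ball z (ρ * t z)).indicator fun x => ENNReal.ofReal ((rot u x - b) ^ 2) := ⟨_, rfl⟩
  have hHm : Measurable H := by
    rw [hH]; exact Measurable.indicator (by fun_prop) measurableSet_ball
  have hHi : ∫⁻ x, H x = ∫⁻ x in ball z (ρ * t z), ENNReal.ofReal ((rot u x - b) ^ 2) := by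
    rw [hH, lintegral_indicator measurableSet_ball]
  have hst : ∫⁻ x, H (x + (ρ / 3 * t x) • ν) ≤ ∫⁻ x, H x := by
    rw [h.lintegral_comp_stretch _ (by positivity) H hHm]
    calc _ ≤ 1 * ∫⁻ x, H x := by
          gcongr
          rw [← ENNReal.ofReal_one]
          refine ENNReal.ofReal_le_ofReal ?_
          exact inv_le_one_of_one_le₀ (by linarith)
      _ = _ := one_mul _
  have hmaps : ∀ x ∈ ball z (ρ / 2 * t z), x ∈ ball z (ρ * t z) ∧
      x + (ρ / 3 * t x) • ν ∈ ball z (ρ * t z) := fun x hx => by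
    rw [mem_ball] at hx
    have h1 := abs_le.1 (h.abs_height_sub_le x z)
    have hK := h.one_le
    have h2 : K * dist x z ≤ t z / 8 := by
      have := mul_le_mul_of_nonneg_left hx.le (by linarith : 0 ≤ K)
      nlinarith
    have hx0 : 0 < t x := by linarith
    refine ⟨mem_ball.2 (by nlinarith), mem_ball.2 ?_⟩
    have h3 : dist (x + (ρ / 3 * t x) • ν) x = ρ / 3 * t x := by
      rw [dist_eq_norm, add_sub_cancel_left, norm_smul, h.norm_dir, mul_one, Real.norm_eq_abs,
        abs_of_pos (by positivity)]
    have h4 := dist_triangle (x + (ρ / 3 * t x) • ν) x z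
    have h5 : ρ * t x ≤ ρ * (9 / 8 * t z) := mul_le_mul_of_nonneg_left (by linarith) hρ.le
    nlinarith
  calc ∫⁻ x in ball z (ρ / 2 * t z),
        ENNReal.ofReal ((rot u x - rot u (x + (ρ / 3 * t x) • ν)) ^ 2)
      ≤ ∫⁻ x in ball z (ρ / 2 * t z), 2 * (H x + H (x + (ρ / 3 * t x) • ν)) := by
        refine setLIntegral_mono' measurableSet_ball fun x hx => ?_
        obtain ⟨h1, h2⟩ := hmaps x hx
        rw [hH, Set.indicator_of_mem h1, Set.indicator_of_mem h2,
          ← ENNReal.ofReal_add (by positivity) (by positivity),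
          two_mul, ← ENNReal.ofReal_add (by positivity) (by positivity)]
        refine ENNReal.ofReal_le_ofReal ?_
        nlinarith [sq_nonneg ((rot u x - b) + (rot u (x + (ρ / 3 * t x) • ν) - b))]
    _ ≤ ∫⁻ x, 2 * (H x + H (x + (ρ / 3 * t x) • ν)) := setLIntegral_le_lintegral _ _
    _ = 2 * ((∫⁻ x, H x) + ∫⁻ x, H (x + (ρ / 3 * t x) • ν)) := by
        rw [lintegral_const_mul' _ _ (by norm_num), lintegral_add_left hHm]
    _ ≤ 2 * ((∫⁻ x, H x) + ∫⁻ x, H x) := by gcongr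
    _ = 4 * ∫⁻ x, H x := by ring
    _ ≤ 4 * (D * ∫⁻ x in ball z (2 * ρ * t z), ENNReal.ofReal (strainSq u x)) := by
        rw [hHi]; gcongr
    _ = _ := by ring

lemma setLIntegral_strip_sub_stretch_sq_le {D : NNReal}
    (hD : ∀ (z : Plane) (r : ℝ), 0 < r → ∀ u : Fin 2 → Plane → ℝ,
      (∀ i, DifferentiableOn ℝ (u i) (ball z (2 * r))) →
      ∫⁻ x in ball z (2 * r), ENNReal.ofReal (gradSq u x) < ⊤ →
      ∃ b : ℝ, ∫⁻ x in ball z r, ENNReal.ofReal ((rot u x - b) ^ 2) ≤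
        D * ∫⁻ x in ball z (2 * r), ENNReal.ofReal (strainSq u x))
    {K : ℝ} {σ t : Plane → ℝ} {ν : Plane} (h : LipschitzChart K σ t ν) {ρ a T : ℝ} (hρ : 0 < ρ)
    (hKρ : K * ρ ≤ 1 / 4) (hT : 0 < T) {u : Fin 2 → Plane → ℝ}
    (hu : ∀ i, DifferentiableOn ℝ (u i) (strip σ t (a + 2 * T) (2 * T)))
    (hg : ∫⁻ x in strip σ t (a + 2 * T) (2 * T), ENNReal.ofReal (gradSq u x) < ⊤) :
    ∫⁻ x in strip σ t a T,
        ENNReal.ofReal ((rot u x - rot u (x + (ρ / 3 * t x) • ν)) ^ 2) ≤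
      ENNReal.ofReal 2304 * (4 * D) *
        ∫⁻ x in strip σ t (a + 2 * T) (2 * T), ENNReal.ofReal (strainSq u x) := by
  have hK := h.one_le
  have hρ4 : ρ ≤ 1 / 4 := by nlinarith
  have htc := h.continuous_height
  have hZR : ∀ z ∈ strip σ t (a + T / 2) (9 / 8 * T), ∀ x, dist x z < 2 * ρ * t z →
      x ∈ strip σ t (a + 2 * T) (2 * T) := fun z hz x hd => by
    obtain ⟨h1, h2, h3⟩ := hz
    have h4 : dist x z < t z / 2 := by nlinarith
    have h5 : K * dist x z < t z / 2 := by
      have := mul_lt_mul_of_pos_left hd (by linarith : 0 < K)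
      nlinarith
    have h6 := abs_le.1 (h.abs_height_sub_le x z)
    have h7 := h.abs_sigma_sub_le x z
    have h8 := abs_sub_abs_le_abs_sub (σ x) (σ z)
    exact ⟨by linarith, by linarith, by linarith⟩
  refine setLIntegral_le_of_whitney (Z := strip σ t (a + T / 2) (9 / 8 * T)) hρ hKρ
    h.abs_height_sub_le htc (h.measurableSet_strip _ _) (h.measurableSet_strip _ _)
    (h.measurableSet_strip _ _) (fun x hx => hx.2.1) (fun x hx => hx.2.1) ?_ hZR ?_ (by fun_prop)
    (ENNReal.mul_ne_top (by norm_num) ENNReal.coe_ne_top) ?_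
  · rintro x ⟨h1, h2, h3⟩ z hd
    have h4 : dist x z < t x / 16 := by nlinarith
    have h5 : K * dist x z < t x / 16 := by
      have := mul_lt_mul_of_pos_left hd (by linarith : 0 < K)
      nlinarith
    have h6 := abs_le.1 (h.abs_height_sub_le x z)
    have h7 := h.abs_sigma_sub_le x z
    have h8 := abs_sub_abs_le_abs_sub (σ z) (σ x)
    rw [abs_sub_comm] at h8
    exact ⟨by linarith, by linarith, by linarith⟩
  · have := htc.measurable
    fun_prop
  · intro z hz
    have hsub : ball z (2 * ρ * t z) ⊆ strip σ t (a + 2 * T) (2 * T) := fun x hx =>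
      hZR z hz x hx
    exact setLIntegral_sub_stretch_sq_le hD h hρ hKρ hz.2.1 (fun i => (hu i).mono hsub)
      ((lintegral_mono_set hsub).trans_lt hg)

/-- A Hardy-type inequality: a function is controlled by its increments under the stretching. -/
lemma setLIntegral_strip_sq_le {K : ℝ} {σ t : Plane → ℝ} {ν : Plane}
    (h : LipschitzChart K σ t ν) {κ a T : ℝ} (hκ : 0 < κ) {g : Plane → ℝ} (hg : Measurable g)
    (hfin : ∫⁻ x in strip σ t a T, ENNReal.ofReal (g x ^ 2) ≠ ⊤) :
    ∫⁻ x in strip σ t a T, ENNReal.ofReal (g x ^ 2) ≤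
      ENNReal.ofReal (2 * (1 + κ) * (2 + κ) / κ ^ 2) *
        ((∫⁻ x in strip σ t a T, ENNReal.ofReal ((g x - g (x + (κ * t x) • ν)) ^ 2)) +
          ∫⁻ x in {x | |σ x| < a ∧ T ≤ t x ∧ t x < (1 + κ) * T}, ENNReal.ofReal (g x ^ 2)) := by
  obtain ⟨B, hB⟩ : ∃ B, B = {x | |σ x| < a ∧ T ≤ t x ∧ t x < (1 + κ) * T} := ⟨_, rfl⟩
  have htc := h.continuous_height
  have hsc := h.continuous_sigma
  have hSm := h.measurableSet_strip a T
  have hBm : MeasurableSet B := by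
    rw [hB]
    exact (isOpen_lt hsc.abs continuous_const).measurableSet.inter
      ((isClosed_le continuous_const htc).measurableSet.inter
      (isOpen_lt htc continuous_const).measurableSet)
  obtain ⟨H, hH⟩ : ∃ H : Plane → ENNReal,
      H = (strip σ t a T ∪ B).indicator fun x => ENNReal.ofReal (g x ^ 2) := ⟨_, rfl⟩
  have hHm : Measurable H := by
    rw [hH]; exact Measurable.indicator (by fun_prop) (hSm.union hBm)
  have hdisj : Disjoint (strip σ t a T) B := by
    rw [hB]
    exact Set.disjoint_left.2 fun x hx hx' => absurd hx.2.2 (not_lt.2 hx'.2.1)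
  rw [← hB]
  obtain ⟨N, hN⟩ : ∃ N, N = ∫⁻ x in strip σ t a T, ENNReal.ofReal (g x ^ 2) := ⟨_, rfl⟩
  obtain ⟨N', hN'⟩ : ∃ N, N = ∫⁻ x in B, ENNReal.ofReal (g x ^ 2) := ⟨_, rfl⟩
  obtain ⟨A, hA⟩ : ∃ A, A = ∫⁻ x in strip σ t a T,
    ENNReal.ofReal ((g x - g (x + (κ * t x) • ν)) ^ 2) := ⟨_, rfl⟩
  have hst : ∫⁻ x, H (x + (κ * t x) • ν) = ENNReal.ofReal (1 + κ)⁻¹ * (N + N') := by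
    rw [h.lintegral_comp_stretch κ hκ H hHm, hH, lintegral_indicator (hSm.union hBm),
      lintegral_union hBm hdisj, hN, hN']
  have key : N ≤ ENNReal.ofReal (1 + 2 / κ) * A +
      ENNReal.ofReal (1 + κ / 2) * (ENNReal.ofReal (1 + κ)⁻¹ * (N + N')) := by
    rw [← hst]
    calc N ≤ ∫⁻ x in strip σ t a T,
          (ENNReal.ofReal (1 + 2 / κ) * ENNReal.ofReal ((g x - g (x + (κ * t x) • ν)) ^ 2) +
            ENNReal.ofReal (1 + κ / 2) * H (x + (κ * t x) • ν)) := by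
          rw [hN]
          refine setLIntegral_mono' hSm fun x hx => ?_
          have hmem : x + (κ * t x) • ν ∈ strip σ t a T ∪ B := by
            obtain ⟨h1, h2, h3⟩ := hx
            have h4 : t (x + (κ * t x) • ν) = (1 + κ) * t x := by rw [h.height_add_smul]; ring
            have h5 : (1 + κ) * t x < (1 + κ) * T := by gcongr
            have h6 : 0 < (1 + κ) * t x := by positivity
            rcases lt_or_ge ((1 + κ) * t x) T with h7 | h7
            · refine Or.inl ⟨by rwa [h.sigma_add_smul], by rwa [h4], by rwa [h4]⟩
            · refine Or.inr ?_
              rw [hB]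
              exact ⟨by rwa [h.sigma_add_smul], by rwa [h4], by rwa [h4]⟩
          rw [hH, Set.indicator_of_mem hmem, ← ENNReal.ofReal_mul (by positivity),
            ← ENNReal.ofReal_mul (by positivity),
            ← ENNReal.ofReal_add (by positivity) (by positivity)]
          refine ENNReal.ofReal_le_ofReal ?_
          generalize g x = p
          generalize g (x + (κ * t x) • ν) = q
          have : (1 + 2 / κ) * (p - q) ^ 2 + (1 + κ / 2) * q ^ 2 - p ^ 2 =
              (2 * (p - q) - κ * q) ^ 2 / (2 * κ) := by
            field_simp; ring
          have h0 : 0 ≤ (2 * (p - q) - κ * q) ^ 2 / (2 * κ) := by positivity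
          linarith
      _ = ENNReal.ofReal (1 + 2 / κ) * A +
          ENNReal.ofReal (1 + κ / 2) * ∫⁻ x in strip σ t a T, H (x + (κ * t x) • ν) := by
          have hm := htc.measurable
          rw [lintegral_add_left (by fun_prop), lintegral_const_mul' _ _ ENNReal.ofReal_ne_top,
            lintegral_const_mul' _ _ ENNReal.ofReal_ne_top, hA]
      _ ≤ _ := by gcongr; exact Measure.restrict_le_self
  rw [← hN] at hfin ⊢
  rw [← hA, ← hN']
  clear hst hN hN' hA
  obtain ⟨θ, hθ⟩ : ∃ θ, θ = (1 + κ / 2) * (1 + κ)⁻¹ := ⟨_, rfl⟩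
  have hθ1 : 1 - θ = κ / (2 * (1 + κ)) := by rw [hθ]; field_simp; ring
  have hθ0 : 0 ≤ θ := by rw [hθ]; positivity
  have hθ2 : 0 ≤ 1 - θ := by rw [hθ1]; positivity
  rw [← mul_assoc, ← ENNReal.ofReal_mul (by positivity), ← hθ] at key
  have hc : ENNReal.ofReal (1 - θ) * N ≤
      ENNReal.ofReal (1 + 2 / κ) * A + ENNReal.ofReal θ * N' := by
    have h1 : ENNReal.ofReal θ * N ≠ ⊤ := ENNReal.mul_ne_top ENNReal.ofReal_ne_top hfin
    rw [← ENNReal.add_le_add_iff_left h1, ← add_mul, ← ENNReal.ofReal_add hθ0 hθ2,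
      add_sub_cancel, ENNReal.ofReal_one, one_mul]
    refine key.trans (le_of_eq ?_)
    ring
  have hinv : ENNReal.ofReal (2 * (1 + κ) / κ) * ENNReal.ofReal (1 - θ) = 1 := by
    rw [← ENNReal.ofReal_mul (by positivity), hθ1, ← ENNReal.ofReal_one]
    congr 1; field_simp
  calc N = ENNReal.ofReal (2 * (1 + κ) / κ) * (ENNReal.ofReal (1 - θ) * N) := by
        rw [← mul_assoc, hinv, one_mul]
    _ ≤ ENNReal.ofReal (2 * (1 + κ) / κ) *
        (ENNReal.ofReal (1 + 2 / κ) * A + ENNReal.ofReal (1 + 2 / κ) * N') := by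
        gcongr
        refine hc.trans ?_
        gcongr
        have : 0 < 2 / κ := by positivity
        linarith
    _ = _ := by
        rw [← mul_add, ← mul_assoc, ← ENNReal.ofReal_mul (by positivity)]
        congr 2; field_simp; ring

lemma exists_rot_approx_strip {D : NNReal}
    (hD : ∀ (z : Plane) (r : ℝ), 0 < r → ∀ u : Fin 2 → Plane → ℝ,
      (∀ i, DifferentiableOn ℝ (u i) (ball z (2 * r))) →
      ∫⁻ x in ball z (2 * r), ENNReal.ofReal (gradSq u x) < ⊤ →
      ∃ b : ℝ, ∫⁻ x in ball z r, ENNReal.ofReal ((rot u x - b) ^ 2) ≤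
        D * ∫⁻ x in ball z (2 * r), ENNReal.ofReal (strainSq u x))
    {K : ℝ} {σ t : Plane → ℝ} {ν P : Plane} (h : LipschitzChart K σ t ν) (hσP : σ P = 0)
    (htP : t P = 0) {ρ a T : ℝ} (hρ : 0 < ρ)
    (hKρ : K * ρ ≤ 1 / 4) (hT : 0 < T) (ha : 0 < a) (hKa : K * a ≤ ρ * T / 4)
    {u : Fin 2 → Plane → ℝ}
    (hu : ∀ i, DifferentiableOn ℝ (u i) (strip σ t (a + 2 * T) (2 * T)))
    (hg : ∫⁻ x in strip σ t (a + 2 * T) (2 * T), ENNReal.ofReal (gradSq u x) < ⊤) :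
    ∃ b : ℝ, ∫⁻ x in strip σ t a T, ENNReal.ofReal ((rot u x - b) ^ 2) ≤
      ENNReal.ofReal (2 * (1 + ρ / 3) * (2 + ρ / 3) / (ρ / 3) ^ 2) *
        (ENNReal.ofReal 2304 * (4 * D) + D) *
        ∫⁻ x in strip σ t (a + 2 * T) (2 * T), ENNReal.ofReal (strainSq u x) := by
  have hK := h.one_le
  have hρ4 : ρ ≤ 1 / 4 := by nlinarith
  obtain ⟨q, hq⟩ : ∃ q, q = P + T • ν := ⟨_, rfl⟩
  have hσq : σ q = 0 := by rw [hq, h.sigma_add_smul, hσP]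
  have htq : t q = T := by rw [hq, h.height_add_smul, htP, zero_add]
  have hball : ball q (2 * (ρ * T)) ⊆ strip σ t (a + 2 * T) (2 * T) := fun x hx => by
    rw [mem_ball] at hx
    have h1 := h.abs_sigma_sub_le x q
    have h2 := abs_le.1 (h.abs_height_sub_le x q)
    rw [hσq, sub_zero] at h1
    rw [htq] at h2
    have h3 : K * dist x q < T / 2 * 1 := by
      have := mul_lt_mul_of_pos_left hx (by linarith : 0 < K)
      nlinarith
    refine ⟨by nlinarith, by linarith, by linarith⟩
  obtain ⟨b, hb⟩ := hD q (ρ * T) (by positivity) u (fun i => (hu i).mono hball)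
    ((lintegral_mono_set hball).trans_lt hg)
  refine ⟨b, ?_⟩
  have hsub : strip σ t a T ⊆ strip σ t (a + 2 * T) (2 * T) := fun x hx =>
    ⟨by linarith [hx.1], hx.2.1, by linarith [hx.2.2]⟩
  have hvol : volume (strip σ t a T) < ⊤ := by
    refine (measure_mono fun x hx => ?_).trans_lt (measure_ball_lt_top (x := P) (r := K * a + T))
    have h1 := h.dist_le x P
    rw [hσP, htP, sub_zero, sub_zero, abs_of_pos hx.2.1] at h1
    have h2 : K * |σ x| ≤ K * a := by gcongr; exact hx.1.le
    rw [mem_ball]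
    linarith [hx.2.2]
  have hfin : ∫⁻ x in strip σ t a T, ENNReal.ofReal ((rot u x - b) ^ 2) ≠ ⊤ := by
    refine (lt_of_le_of_lt (b := ∫⁻ x in strip σ t a T,
      (2 * ENNReal.ofReal (gradSq u x) + ENNReal.ofReal (2 * b ^ 2))) ?_ ?_).ne
    · refine lintegral_mono fun x => ?_
      rw [two_mul, ← ENNReal.ofReal_add (gradSq_nonneg u x) (gradSq_nonneg u x),
        ← ENNReal.ofReal_add (by linarith [gradSq_nonneg u x]) (by positivity)]
      refine ENNReal.ofReal_le_ofReal ?_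
      have := rot_sq_le_gradSq u x
      nlinarith [sq_nonneg (rot u x + b)]
    · rw [lintegral_add_right _ measurable_const, lintegral_const_mul' _ _ (by norm_num),
        setLIntegral_const]
      exact ENNReal.add_lt_top.2 ⟨ENNReal.mul_lt_top (by norm_num)
        ((lintegral_mono_set hsub).trans_lt hg), ENNReal.mul_lt_top ENNReal.ofReal_lt_top hvol⟩
  have main := setLIntegral_strip_sq_le h (κ := ρ / 3) (by positivity)
    (g := fun x => rot u x - b) (by fun_prop) hfin
  have hA := setLIntegral_strip_sub_stretch_sq_le hD h hρ hKρ hT hu hg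
  have htop : ∫⁻ x in {x | |σ x| < a ∧ T ≤ t x ∧ t x < (1 + ρ / 3) * T},
      ENNReal.ofReal ((rot u x - b) ^ 2) ≤
      D * ∫⁻ x in strip σ t (a + 2 * T) (2 * T), ENNReal.ofReal (strainSq u x) := by
    refine (lintegral_mono_set fun x hx => ?_).trans
      (hb.trans (by gcongr))
    obtain ⟨h1, h2, h3⟩ := hx
    have h4 := h.dist_le x q
    rw [hσq, htq, sub_zero, abs_of_nonneg (by linarith : 0 ≤ t x - T)] at h4
    have h2 : K * |σ x| ≤ K * a := by gcongr
    have h5 : 0 < ρ * T := by positivity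
    rw [mem_ball]
    linarith
  refine main.trans ?_
  rw [mul_assoc (ENNReal.ofReal _), add_mul _ (D : ENNReal)]
  gcongr
  refine le_trans (le_of_eq ?_) hA
  refine lintegral_congr fun x => ?_
  rw [sub_sub_sub_cancel_right]

lemma exists_chart_of_lipschitzBoundary {Ω : Set Plane} {ρ₀ M₀ : ℝ} (hM : 0 < M₀) (hρ₀ : 0 < ρ₀)
    (hΩ : LipschitzBoundary Ω ρ₀ M₀) {P : Plane} (hP : P ∈ frontier Ω) :
    ∃ σ t ν, LipschitzChart (1 + M₀) σ t ν ∧ σ P = 0 ∧ t P = 0 ∧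
      ∀ x, |σ x| < 3 * (ρ₀ / (8 * (1 + M₀) ^ 2)) → |t x| < 2 * (ρ₀ / (8 * (1 + M₀) ^ 2)) →
        (x ∈ Ω ↔ 0 < t x) := by
  obtain ⟨f, ψ, hfP, hψ0, hψ, -, hf⟩ := hΩ P hP
  obtain ⟨ν, hν⟩ := exists_lipschitzChart f hM.le hψ
  refine ⟨_, _, ν, hν, by rw [hfP]; rfl, by rw [hfP]; simp [hψ0], fun x h1 h2 => ?_⟩
  obtain ⟨T, hT⟩ : ∃ T, T = ρ₀ / (8 * (1 + M₀) ^ 2) := ⟨_, rfl⟩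
  have hT' : ρ₀ = T * (8 * (1 + M₀) ^ 2) := by rw [hT]; field_simp
  have hT0 : 0 < T := by rw [hT]; positivity
  rw [← hT] at h1 h2
  have hψx : |ψ (f x 0)| ≤ M₀ * |f x 0| := by
    have := hψ.dist_le_mul (f x 0) 0
    rwa [hψ0, Real.dist_eq, Real.dist_eq, sub_zero, sub_zero, Real.coe_toNNReal M₀ hM.le] at this
  have h3 : |f x 1| ≤ |f x 1 - ψ (f x 0)| + |ψ (f x 0)| := by
    have := abs_add_le (f x 1 - ψ (f x 0)) (ψ (f x 0))
    rwa [sub_add_cancel] at this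
  have h4 : M₀ * |f x 0| ≤ M₀ * (3 * T) := by gcongr
  rw [hf x ?_ ?_, sub_pos]
  · rw [lt_div_iff₀ hM, hT']
    nlinarith [mul_pos hT0 hM, mul_pos (mul_pos hT0 hM) hM]
  · rw [hT']
    nlinarith [mul_pos hT0 hM, mul_pos (mul_pos hT0 hM) hM]

lemma exists_local_rot_approx {M₀ : ℝ} (hM : 0 < M₀) :
    ∃ δ > 0, ∃ η > 0, ∃ C : NNReal, ∀ (Ω : Set Plane) (ρ₀ : ℝ), 0 < ρ₀ →
      LipschitzBoundary Ω ρ₀ M₀ → ∀ u : Fin 2 → Plane → ℝ,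
      (∀ i, DifferentiableOn ℝ (u i) Ω) → ∫⁻ x in Ω, ENNReal.ofReal (gradSq u x) < ⊤ →
      ∀ x ∈ Ω, (∃ y, ball y (η * ρ₀) ⊆ Ω ∩ ball x (δ * ρ₀)) ∧
        ∃ b : ℝ, ∫⁻ y in Ω ∩ ball x (2 * (δ * ρ₀)), ENNReal.ofReal ((rot u y - b) ^ 2) ≤
          C * ∫⁻ y in Ω, ENNReal.ofReal (strainSq u y) := by
  obtain ⟨D, hD⟩ := exists_rot_approx
  obtain ⟨K, hK⟩ : ∃ K, K = 1 + M₀ := ⟨_, rfl⟩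
  have hK1 : 1 ≤ K := by linarith
  have hK0 : 0 < K := by linarith
  obtain ⟨ρ, hρ⟩ : ∃ ρ, ρ = 1 / (4 * K) := ⟨_, rfl⟩
  have hρ0 : 0 < ρ := by rw [hρ]; positivity
  have hKρ : K * ρ ≤ 1 / 4 := by rw [hρ]; apply le_of_eq; field_simp
  obtain ⟨α, hα⟩ : ∃ α, α = ρ * (1 / (8 * K ^ 2)) / (4 * K) := ⟨_, rfl⟩
  have hα0 : 0 < α := by rw [hα]; positivity
  obtain ⟨c, hc⟩ : ∃ c, c = Real.toNNReal (2 * (1 + ρ / 3) * (2 + ρ / 3) / (ρ / 3) ^ 2) *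
    (2304 * (4 * D) + D) := ⟨_, rfl⟩
  refine ⟨α / 8, by positivity, α / (32 * K), by positivity, max D c, ?_⟩
  intro Ω ρ₀ hρ₀ hΩ u hu hg x hx
  obtain ⟨T, hT⟩ : ∃ T, T = ρ₀ / (8 * K ^ 2) := ⟨_, rfl⟩
  obtain ⟨a, ha⟩ : ∃ a, a = α * ρ₀ := ⟨_, rfl⟩
  have hT0 : 0 < T := by rw [hT]; positivity
  have ha0 : 0 < a := by rw [ha]; positivity
  have haT : K * a = ρ * T / 4 := by rw [ha, hα, hT]; field_simp
  have e1 : α / 8 * ρ₀ = a / 8 := by rw [ha]; ring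
  have e2 : α / (32 * K) * ρ₀ = a / (32 * K) := by rw [ha]; ring
  rw [e1, e2]
  have hr : a / (32 * K) ≤ a / 32 := by
    rw [div_le_div_iff₀ (by positivity) (by norm_num)]; nlinarith
  have hρ4 : ρ ≤ 1 / 4 := by nlinarith
  have hKaT : K * a ≤ T / 16 := by rw [haT]; nlinarith
  have haT' : a ≤ T / 16 := by nlinarith
  by_cases hdeep : ball x (a / 2) ⊆ Ω
  · refine ⟨⟨x, fun y hy => ⟨hdeep (ball_subset_ball (by linarith) hy),
      ball_subset_ball (by linarith) hy⟩⟩, ?_⟩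
    have e3 : 2 * (a / 4) = a / 2 := by ring
    obtain ⟨b, hb⟩ := hD x (a / 4) (by positivity) u
      (by rw [e3]; exact fun i => (hu i).mono hdeep)
      (by rw [e3]; exact (lintegral_mono_set hdeep).trans_lt hg)
    refine ⟨b, ?_⟩
    rw [e3] at hb
    have e4 : 2 * (a / 8) = a / 4 := by ring
    rw [e4]
    refine (lintegral_mono_set Set.inter_subset_right).trans (hb.trans ?_)
    gcongr
    exact le_max_left _ _
  · obtain ⟨y, hy, hyΩ⟩ := Set.not_subset.1 hdeep
    obtain ⟨P, hP, hPd⟩ := exists_mem_frontier_infDist_compl_eq_dist hx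
      (fun h => hyΩ (h ▸ Set.mem_univ y))
    have hxP : dist x P < a / 2 := by
      rw [← hPd]
      refine (infDist_le_dist_of_mem hyΩ).trans_lt ?_
      rwa [dist_comm, ← mem_ball]
    obtain ⟨σ, t, ν, h, hσP, htP, hiff⟩ := exists_chart_of_lipschitzBoundary hM hρ₀ hΩ hP
    rw [← hK] at h hiff
    rw [← hT] at hiff
    have hσ : ∀ z r, dist z P < r → |σ z| < r := fun z r hz => by
      have := h.abs_sigma_sub_le z P
      rw [hσP, sub_zero] at this
      linarith
    have ht : ∀ z r, dist z P < r → |t z| < K * r := fun z r hz => by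
      have := h.abs_height_sub_le z P
      rw [htP, sub_zero] at this
      have h2 := mul_lt_mul_of_pos_left hz hK0
      linarith
    have hR : strip σ t (a + 2 * T) (2 * T) ⊆ Ω := fun z hz =>
      (hiff z (by linarith [hz.1]) (by rw [abs_of_pos hz.2.1]; exact hz.2.2)).2 hz.2.1
    have hS : Ω ∩ ball P a ⊆ strip σ t a T := fun z hz => by
      have h1 := hσ z a hz.2
      have h2 := ht z a hz.2
      have h3 := (hiff z (by linarith) (by linarith)).1 hz.1
      exact ⟨h1, h3, by linarith [le_abs_self (t z)]⟩
    have hxt := (hS ⟨hx, mem_ball.2 (by linarith)⟩).2.1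
    constructor
    · have hd : dist (x + (a / 16) • ν) x = a / 16 := by
        rw [dist_eq_norm, add_sub_cancel_left, norm_smul, h.norm_dir, mul_one, Real.norm_eq_abs,
          abs_of_pos (by positivity)]
      refine ⟨x + (a / 16) • ν, fun z hz => ?_⟩
      rw [mem_ball] at hz
      have hzx : dist z x < a / 8 := by
        linarith [dist_triangle z (x + (a / 16) • ν) x]
      have hzP : dist z P < a := by linarith [dist_triangle z x P]
      refine ⟨(hiff z ?_ ?_).2 ?_, mem_ball.2 hzx⟩
      · linarith [hσ z a hzP]
      · linarith [ht z a hzP]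
      · have h1 := abs_le.1 (h.abs_height_sub_le z (x + (a / 16) • ν))
        have h2 := mul_lt_mul_of_pos_left hz hK0
        have h3 : K * (a / (32 * K)) = a / 32 := by field_simp
        rw [h.height_add_smul] at h1
        linarith
    · obtain ⟨b, hb⟩ := exists_rot_approx_strip hD h hσP htP hρ0 hKρ hT0 ha0 haT.le
        (fun i => (hu i).mono hR) ((lintegral_mono_set hR).trans_lt hg)
      refine ⟨b, ?_⟩
      calc ∫⁻ y in Ω ∩ ball x (2 * (a / 8)), ENNReal.ofReal ((rot u y - b) ^ 2)
          ≤ ∫⁻ y in strip σ t a T, ENNReal.ofReal ((rot u y - b) ^ 2) := by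
            refine lintegral_mono_set fun z hz => hS ⟨hz.1, mem_ball.2 ?_⟩
            linarith [dist_triangle z x P, mem_ball.1 hz.2]
        _ ≤ c * ∫⁻ y in strip σ t (a + 2 * T) (2 * T), ENNReal.ofReal (strainSq u y) := by
            refine hb.trans (le_of_eq ?_)
            rw [hc]
            push_cast
            rw [ENNReal.ofReal_ofNat]
            rfl
        _ ≤ (max D c : NNReal) * ∫⁻ y in Ω, ENNReal.ofReal (strainSq u y) := by
            gcongr
            exact le_max_right _ _

/-- On a connected set covered by `N` balls of radius `r / 2`, a function varying by at most `k`
at scale `r` has oscillation at most `(2 N + 1) k`. -/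
lemma sub_le_of_isPreconnected_of_cover {X : Set Plane} (hX : IsPreconnected X) {r k : ℝ}
    (hr : 0 < r) (hk : 0 ≤ k) {B : Plane → ℝ}
    (hB : ∀ x ∈ X, ∀ y ∈ X, dist x y < r → |B x - B y| ≤ k) (s : Finset Plane)
    (hs : X ⊆ ⋃ c ∈ s, ball c (r / 2)) {x y : Plane} (hx : x ∈ X) (hy : y ∈ X) :
    B y - B x ≤ (2 * s.card + 1) * k := by
  by_contra! hlt
  have gap : ∀ j ∈ Finset.range (s.card + 1),
      ∃ z ∈ X, B x + 2 * j * k < B z ∧ B z ≤ B x + 2 * j * k + k := fun j hj => by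
    by_contra! hno
    obtain ⟨c, hc⟩ : ∃ c, c = B x + 2 * j * k := ⟨_, rfl⟩
    rw [← hc] at hno
    have hj' : (j : ℝ) ≤ s.card := by exact_mod_cast Nat.lt_succ_iff.1 (Finset.mem_range.1 hj)
    have hxc : B x ≤ c := by rw [hc]; nlinarith [mul_nonneg (Nat.cast_nonneg (α := ℝ) j) hk]
    have hyc : c + k < B y := by
      rw [hc]; nlinarith [mul_le_mul_of_nonneg_right hj' hk]
    have hcov : X ⊆ (⋃ p ∈ {p ∈ X | B p ≤ c}, ball p r) ∪ ⋃ p ∈ {p ∈ X | c + k < B p}, ball p r :=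
      fun p hp => by
        rcases le_or_gt (B p) c with h | h
        · exact Or.inl (Set.mem_biUnion ⟨hp, h⟩ (mem_ball_self hr))
        · exact Or.inr (Set.mem_biUnion (show p ∈ {p ∈ X | c + k < B p} from ⟨hp, hno p hp h⟩)
            (mem_ball_self hr))
    obtain ⟨q, hq, hq1, hq2⟩ := hX _ _ (isOpen_biUnion fun p _ => isOpen_ball)
      (isOpen_biUnion fun p _ => isOpen_ball) hcov
      ⟨x, hx, Set.mem_biUnion (show x ∈ {p ∈ X | B p ≤ c} from ⟨hx, hxc⟩) (mem_ball_self hr)⟩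
      ⟨y, hy, Set.mem_biUnion (show y ∈ {p ∈ X | c + k < B p} from ⟨hy, hyc⟩) (mem_ball_self hr)⟩
    obtain ⟨p, ⟨hp, hpc⟩, hqp⟩ := Set.mem_iUnion₂.1 hq1
    obtain ⟨p', ⟨hp', hpc'⟩, hqp'⟩ := Set.mem_iUnion₂.1 hq2
    have h1 := abs_le.1 (hB q hq p hp hqp)
    have h2 := abs_le.1 (hB q hq p' hp' hqp')
    have h3 := hno q hq (by linarith)
    linarith
  choose! z hzX hz1 hz2 using gap
  have hcen : ∀ j ∈ Finset.range (s.card + 1), ∃ c ∈ s, z j ∈ ball c (r / 2) := fun j hj => by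
    obtain ⟨c, hc, h⟩ := Set.mem_iUnion₂.1 (hs (hzX j hj))
    exact ⟨c, hc, h⟩
  choose! c hcs hc using hcen
  have key : ∀ i ∈ Finset.range (s.card + 1), ∀ j ∈ Finset.range (s.card + 1), i < j →
      c i ≠ c j := fun i hi j hj hij he => by
    have h1 := mem_ball.1 (hc i hi)
    have h2 := mem_ball'.1 (hc j hj)
    rw [← he] at h2
    have h3 := abs_le.1 (hB _ (hzX i hi) _ (hzX j hj)
      (by linarith [dist_triangle (z i) (c i) (z j)]))
    have h4 : (i : ℝ) + 1 ≤ j := by exact_mod_cast hij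
    have h5 := mul_le_mul_of_nonneg_right h4 hk
    linarith [hz1 j hj, hz2 i hi]
  obtain ⟨i, hi, j, hj, hij, he⟩ := Finset.exists_ne_map_eq_of_card_lt_of_maps_to
    (s := Finset.range (s.card + 1)) (t := s) (by simp) hcs
  rcases lt_or_gt_of_ne hij with h | h
  · exact key i hi j hj h he
  · exact key j hj i hi h he.symm

lemma ofReal_sq_sub_le (p q s : ℝ) : ENNReal.ofReal ((p - q) ^ 2) ≤
    2 * (ENNReal.ofReal ((p - s) ^ 2) + ENNReal.ofReal ((s - q) ^ 2)) := by
  rw [← ENNReal.ofReal_add (by positivity) (by positivity), two_mul,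
    ← ENNReal.ofReal_add (by positivity) (by positivity)]
  refine ENNReal.ofReal_le_ofReal ?_
  nlinarith [sq_nonneg ((p - s) - (s - q))]

lemma setLIntegral_sq_sub_le (g : Plane → ℝ) (A : Set Plane) (b b' : ℝ) :
    ∫⁻ x in A, ENNReal.ofReal ((g x - b) ^ 2) ≤
      2 * ((∫⁻ x in A, ENNReal.ofReal ((g x - b') ^ 2)) +
        ENNReal.ofReal ((b' - b) ^ 2) * volume A) := by
  calc ∫⁻ x in A, ENNReal.ofReal ((g x - b) ^ 2)
      ≤ ∫⁻ x in A, 2 * (ENNReal.ofReal ((g x - b') ^ 2) + ENNReal.ofReal ((b' - b) ^ 2)) :=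
        lintegral_mono fun x => ofReal_sq_sub_le _ _ _
    _ = _ := by
        rw [lintegral_const_mul' _ _ (by norm_num), lintegral_add_right _ measurable_const,
          setLIntegral_const]

lemma ofReal_sq_sub_mul_volume_le {g : Plane → ℝ} (hg : Measurable g) (A : Set Plane) (b b' : ℝ) :
    ENNReal.ofReal ((b - b') ^ 2) * volume A ≤
      2 * ((∫⁻ x in A, ENNReal.ofReal ((g x - b) ^ 2)) +
        ∫⁻ x in A, ENNReal.ofReal ((g x - b') ^ 2)) := by
  calc ENNReal.ofReal ((b - b') ^ 2) * volume A
      = ∫⁻ x in A, ENNReal.ofReal ((b - b') ^ 2) := (setLIntegral_const _ _).symm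
    _ ≤ ∫⁻ x in A, 2 * (ENNReal.ofReal ((g x - b) ^ 2) + ENNReal.ofReal ((g x - b') ^ 2)) := by
        refine lintegral_mono fun x => (ofReal_sq_sub_le b b' (g x)).trans (le_of_eq ?_)
        rw [sub_sq_comm b]
    _ = _ := by
        rw [lintegral_const_mul' _ _ (by norm_num), lintegral_add_right _ (by fun_prop)]

lemma setLIntegral_biUnion_finset_le (s : Finset Plane) (A : Plane → Set Plane)
    (F : Plane → ENNReal) :
    ∫⁻ x in ⋃ c ∈ s, A c, F x ≤ ∑ c ∈ s, ∫⁻ x in A c, F x := by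
  classical
  induction s using Finset.induction with
  | empty => simp
  | insert c s hc ih =>
    rw [Finset.set_biUnion_insert, Finset.sum_insert hc]
    refine (lintegral_union_le _ _ _).trans ?_
    gcongr

lemma exists_finset_cover (M : ℝ) {δ : ℝ} (hδ : 0 < δ) : ∃ N : ℕ, ∀ (X : Set Plane) (ρ₀ : ℝ),
    0 < ρ₀ → Bornology.IsBounded X → diam X ≤ M * ρ₀ →
    ∃ s : Finset Plane, s.card ≤ N ∧ X ⊆ ⋃ c ∈ s, ball c (δ * ρ₀) := by
  classical
  obtain ⟨t, -, htf, ht⟩ := (isCompact_closedBall (0 : Plane) M).finite_cover_balls hδ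
  refine ⟨htf.toFinset.card, fun X ρ₀ hρ₀ hX hd => ?_⟩
  rcases X.eq_empty_or_nonempty with rfl | ⟨x₀, hx₀⟩
  · exact ⟨∅, by simp, by simp⟩
  refine ⟨htf.toFinset.image fun y => x₀ + ρ₀ • y, Finset.card_image_le, fun x hx => ?_⟩
  have hmem : ρ₀⁻¹ • (x - x₀) ∈ closedBall (0 : Plane) M := by
    rw [mem_closedBall_zero_iff, norm_smul, ← dist_eq_norm, norm_inv, Real.norm_eq_abs,
      abs_of_pos hρ₀, inv_mul_le_iff₀ hρ₀]
    linarith [dist_le_diam_of_mem hX hx hx₀]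
  obtain ⟨y, hy, hxy⟩ := Set.mem_iUnion₂.1 (ht hmem)
  refine Set.mem_iUnion₂.2 ⟨x₀ + ρ₀ • y,
    Finset.mem_image_of_mem _ (htf.mem_toFinset.2 hy), ?_⟩
  rw [mem_ball, dist_eq_norm] at hxy ⊢
  have e : x - (x₀ + ρ₀ • y) = ρ₀ • (ρ₀⁻¹ • (x - x₀) - y) := by
    rw [smul_sub, smul_inv_smul₀ hρ₀.ne']; abel
  rw [e, norm_smul, Real.norm_eq_abs, abs_of_pos hρ₀, mul_comm]
  gcongr

lemma exists_global_rot_approx {M₀ : ℝ} (hM : 0 < M₀) (M₁ : ℝ) :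
    ∃ C : NNReal, ∀ (Ω : Set Plane) (ρ₀ : ℝ), 0 < ρ₀ → IsOpen Ω → IsConnected Ω →
      Bornology.IsBounded Ω → LipschitzBoundary Ω ρ₀ M₀ → diam Ω ≤ M₁ * ρ₀ →
      ∀ u : Fin 2 → Plane → ℝ, (∀ i, DifferentiableOn ℝ (u i) Ω) →
      ∫⁻ x in Ω, ENNReal.ofReal (gradSq u x) < ⊤ →
      ∃ b : ℝ, ∫⁻ y in Ω, ENNReal.ofReal ((rot u y - b) ^ 2) ≤
        C * ∫⁻ y in Ω, ENNReal.ofReal (strainSq u y) := by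
  obtain ⟨δ, hδ, η, hη, C, hC⟩ := exists_local_rot_approx hM
  obtain ⟨N, hN⟩ := exists_finset_cover M₁ (half_pos hδ)
  obtain ⟨V, hV⟩ : ∃ V, V = (volume (ball (0 : Plane) 1)).toReal := ⟨_, rfl⟩
  have hV0 : 0 < V := hV ▸ ENNReal.toReal_pos (measure_ball_pos _ _ (by norm_num)).ne'
    measure_ball_lt_top.ne
  have hvol : ∀ (z : Plane) {r : ℝ}, 0 ≤ r → volume (ball z r) = ENNReal.ofReal (r ^ 2 * V) :=
    fun z r hr => by
      rw [volume_ball_eq z hr, ENNReal.ofReal_mul (by positivity), hV,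
        ENNReal.ofReal_toReal measure_ball_lt_top.ne]
  refine ⟨Real.toNNReal (N * (2 * C + 8 * (2 * N + 1) ^ 2 * C * δ ^ 2 / η ^ 2)), ?_⟩
  intro Ω ρ₀ hρ₀ hΩo hΩc hΩb hΩ hd u hu hg
  obtain ⟨I, hI⟩ : ∃ I, I = (∫⁻ y in Ω, ENNReal.ofReal (strainSq u y)).toReal := ⟨_, rfl⟩
  have hI0 : 0 ≤ I := hI ▸ ENNReal.toReal_nonneg
  have hfin : ∫⁻ y in Ω, ENNReal.ofReal (strainSq u y) = ENNReal.ofReal I := by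
    rw [hI, ENNReal.ofReal_toReal]
    refine (lt_of_le_of_lt (lintegral_mono fun x => ?_) hg).ne
    exact ENNReal.ofReal_le_ofReal (strainSq_le_gradSq u x)
  have loc := hC Ω ρ₀ hρ₀ hΩ u hu hg
  rw [hfin] at loc ⊢
  have hCI : (C : ENNReal) * ENNReal.ofReal I = ENNReal.ofReal (C * I) := by
    rw [ENNReal.ofReal_mul C.coe_nonneg, ENNReal.ofReal_coe_nnreal]
  rw [hCI] at loc
  have hball : ∀ x ∈ Ω, ∃ y, ball y (η * ρ₀) ⊆ Ω ∩ ball x (δ * ρ₀) := fun x hx => (loc x hx).1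
  have hrot := fun x hx => (loc x hx).2
  choose! B hB using hrot
  obtain ⟨s, hsN, hs⟩ := hN Ω ρ₀ hρ₀ hΩb hd
  obtain ⟨k, hk⟩ : ∃ k, k = Real.sqrt (4 * (C * I) / ((η * ρ₀) ^ 2 * V)) := ⟨_, rfl⟩
  have hk0 : 0 ≤ k := hk ▸ Real.sqrt_nonneg _
  have hk2 : k ^ 2 = 4 * (C * I) / ((η * ρ₀) ^ 2 * V) := by
    rw [hk, Real.sq_sqrt (by positivity)]
  have hnear : ∀ x ∈ Ω, ∀ y ∈ Ω, dist x y < δ * ρ₀ → |B x - B y| ≤ k := fun x hx y hy hxy => by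
    rw [hk]
    refine Real.abs_le_sqrt ?_
    rw [le_div_iff₀ (by positivity), ← ENNReal.ofReal_le_ofReal_iff (by positivity),
      ENNReal.ofReal_mul (by positivity)]
    obtain ⟨z, hz⟩ := hball x hx
    have h1 := ofReal_sq_sub_mul_volume_le (measurable_rot u) (ball z (η * ρ₀)) (B x) (B y)
    rw [hvol z (by positivity)] at h1
    refine h1.trans ?_
    have h2 : ∫⁻ p in ball z (η * ρ₀), ENNReal.ofReal ((rot u p - B x) ^ 2) ≤
        ENNReal.ofReal (C * I) := by
      refine (lintegral_mono_set fun p hp => ?_).trans (hB x hx)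
      refine ⟨(hz hp).1, ball_subset_ball ?_ (hz hp).2⟩
      nlinarith [mul_pos hδ hρ₀]
    have h3 : ∫⁻ p in ball z (η * ρ₀), ENNReal.ofReal ((rot u p - B y) ^ 2) ≤
        ENNReal.ofReal (C * I) := by
      refine (lintegral_mono_set fun p hp => ?_).trans (hB y hy)
      refine ⟨(hz hp).1, ?_⟩
      have := mem_ball.1 (hz hp).2
      rw [mem_ball]
      linarith [dist_triangle p x y]
    calc _ ≤ 2 * (ENNReal.ofReal (C * I) + ENNReal.ofReal (C * I)) := by gcongr
      _ = _ := by
          rw [← ENNReal.ofReal_add (by positivity) (by positivity), two_mul,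
            ← ENNReal.ofReal_add (by positivity) (by positivity)]
          congr 1; ring
  have hfar : ∀ x ∈ Ω, ∀ y ∈ Ω, (B x - B y) ^ 2 ≤ (2 * N + 1) ^ 2 * k ^ 2 := fun x hx y hy => by
    have hs' : Ω ⊆ ⋃ c ∈ s, ball c (δ * ρ₀ / 2) := by
      rwa [div_mul_eq_mul_div] at hs
    have hcard : ((s.card : ℝ)) ≤ N := by exact_mod_cast hsN
    have hle : (2 * (s.card : ℝ) + 1) * k ≤ (2 * N + 1) * k := by gcongr
    have h1 := (sub_le_of_isPreconnected_of_cover hΩc.isPreconnected (by positivity) hk0 hnear s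
      hs' hx hy).trans hle
    have h2 := (sub_le_of_isPreconnected_of_cover hΩc.isPreconnected (by positivity) hk0 hnear s
      hs' hy hx).trans hle
    rw [← mul_pow]
    exact sq_le_sq' (by linarith) h2
  obtain ⟨x₀, hx₀⟩ := hΩc.nonempty
  refine ⟨B x₀, ?_⟩
  have hcell : ∀ c ∈ s, ∫⁻ y in Ω ∩ ball c (δ / 2 * ρ₀), ENNReal.ofReal ((rot u y - B x₀) ^ 2) ≤
      ENNReal.ofReal ((2 * C + 8 * (2 * N + 1) ^ 2 * C * δ ^ 2 / η ^ 2) * I) := fun c hc => by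
    rcases (Ω ∩ ball c (δ / 2 * ρ₀)).eq_empty_or_nonempty with h | ⟨x, hx, hxc⟩
    · rw [h]; simp
    · have hsub : Ω ∩ ball c (δ / 2 * ρ₀) ⊆ Ω ∩ ball x (δ * ρ₀) := fun y hy => by
        have h1 := mem_ball.1 hy.2
        rw [mem_ball'] at hxc
        exact ⟨hy.1, mem_ball.2 (by linarith [dist_triangle y c x])⟩
      calc ∫⁻ y in Ω ∩ ball c (δ / 2 * ρ₀), ENNReal.ofReal ((rot u y - B x₀) ^ 2)
          ≤ ∫⁻ y in Ω ∩ ball x (δ * ρ₀), ENNReal.ofReal ((rot u y - B x₀) ^ 2) :=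
            lintegral_mono_set hsub
        _ ≤ 2 * ((∫⁻ y in Ω ∩ ball x (δ * ρ₀), ENNReal.ofReal ((rot u y - B x) ^ 2)) +
            ENNReal.ofReal ((B x - B x₀) ^ 2) * volume (Ω ∩ ball x (δ * ρ₀))) :=
            setLIntegral_sq_sub_le _ _ _ _
        _ ≤ 2 * (ENNReal.ofReal (C * I) +
            ENNReal.ofReal ((2 * N + 1) ^ 2 * k ^ 2) * ENNReal.ofReal ((δ * ρ₀) ^ 2 * V)) := by
            rw [← hvol x (by positivity)]
            gcongr
            · refine (lintegral_mono_set ?_).trans (hB x hx)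
              refine Set.inter_subset_inter_right _ (ball_subset_ball ?_)
              nlinarith [mul_pos hδ hρ₀]
            · exact hfar x hx x₀ hx₀
            · exact Set.inter_subset_right
        _ = _ := by
            rw [← ENNReal.ofReal_mul (by positivity),
              ← ENNReal.ofReal_add (by positivity) (by positivity), two_mul,
              ← ENNReal.ofReal_add (by positivity) (by positivity), hk2]
            congr 1; field_simp; ring
  calc ∫⁻ y in Ω, ENNReal.ofReal ((rot u y - B x₀) ^ 2)
      ≤ ∫⁻ y in ⋃ c ∈ s, Ω ∩ ball c (δ / 2 * ρ₀), ENNReal.ofReal ((rot u y - B x₀) ^ 2) := by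
        refine lintegral_mono_set fun y hy => ?_
        obtain ⟨c, hc, hyc⟩ := Set.mem_iUnion₂.1 (hs hy)
        exact Set.mem_iUnion₂.2 ⟨c, hc, hy, hyc⟩
    _ ≤ ∑ c ∈ s, ∫⁻ y in Ω ∩ ball c (δ / 2 * ρ₀), ENNReal.ofReal ((rot u y - B x₀) ^ 2) :=
        setLIntegral_biUnion_finset_le _ _ _
    _ ≤ ∑ c ∈ s, ENNReal.ofReal ((2 * C + 8 * (2 * N + 1) ^ 2 * C * δ ^ 2 / η ^ 2) * I) :=
        Finset.sum_le_sum hcell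
    _ ≤ N * ENNReal.ofReal ((2 * C + 8 * (2 * N + 1) ^ 2 * C * δ ^ 2 / η ^ 2) * I) := by
        rw [Finset.sum_const, nsmul_eq_mul]
        gcongr
    _ = _ := by
        rw [← ENNReal.ofReal_natCast, ← ENNReal.ofReal_mul (by positivity), ← mul_assoc,
          ENNReal.ofReal_mul (by positivity)]
        rfl

lemma exists_lintegral_gradSq_le {M₀ M₁ s₀ : ℝ} (hM₀ : 0 < M₀) (hM₁ : 0 < M₁) (hs₀ : 0 < s₀) :
    ∃ A : ℝ, 0 < A ∧ ∀ (Ω : Set Plane) (ρ₀ : ℝ) (x₀ : Plane), 0 < ρ₀ → IsOpen Ω →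
      IsConnected Ω → Bornology.IsBounded Ω → LipschitzBoundary Ω ρ₀ M₀ → diam Ω ≤ M₁ * ρ₀ →
      ball x₀ (s₀ * ρ₀) ⊆ Ω →
      ∀ (u : Fin 2 → Plane → ℝ) (w : Plane → ℝ), (∀ i, DifferentiableOn ℝ (u i) Ω) →
      DifferentiableOn ℝ w Ω → ∫⁻ x in Ω, ENNReal.ofReal (gradSq u x) < ⊤ →
      ∀ I J : ℝ, 0 ≤ I → 0 ≤ J → ∫⁻ x in Ω, ENNReal.ofReal (strainSq u x) = ENNReal.ofReal I →
      ∫⁻ x in Ω, ENNReal.ofReal (shear u w 0 x ^ 2 + shear u w 1 x ^ 2) = ENNReal.ofReal J →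
      ∫⁻ x in Ω, ENNReal.ofReal (gradSq u x) ≤ ENNReal.ofReal (A * (I + J / ρ₀ ^ 2)) := by
  obtain ⟨C₁, hC₁⟩ := exists_global_rot_approx hM₀ M₁
  obtain ⟨C₂, hC₂⟩ := exists_rotation_bound
  obtain ⟨V, hV⟩ : ∃ V, V = (volume (ball (0 : Plane) 1)).toReal := ⟨_, rfl⟩
  have hV0 : 0 ≤ V := hV ▸ ENNReal.toReal_nonneg
  refine ⟨1 + 4 * C₁ + 16 * M₁ ^ 2 * V * C₂ * C₁ / s₀ ^ 2 + 16 * M₁ ^ 2 * V * C₂ / s₀ ^ 4,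
    by positivity, ?_⟩
  intro Ω ρ₀ x₀ hρ₀ hΩo hΩc hΩb hΩ hd hball u w hu hw hg I J hI0 hJ0 hI hJ
  obtain ⟨b, hb⟩ := hC₁ Ω ρ₀ hρ₀ hΩo hΩc hΩb hΩ hd u hu hg
  have hCI : (C₁ : ENNReal) * ENNReal.ofReal I = ENNReal.ofReal (C₁ * I) := by
    rw [ENNReal.ofReal_mul C₁.coe_nonneg, ENNReal.ofReal_coe_nnreal]
  rw [hI, hCI] at hb
  have hx₀ : x₀ ∈ Ω := hball (mem_ball_self (by positivity))
  have hvol : volume Ω ≤ ENNReal.ofReal ((2 * (M₁ * ρ₀)) ^ 2 * V) := by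
    rw [ENNReal.ofReal_mul (by positivity), hV,
      ENNReal.ofReal_toReal measure_ball_lt_top.ne, ← volume_ball_eq x₀ (by positivity)]
    refine measure_mono fun x hx => ?_
    rw [mem_ball]
    have := dist_le_diam_of_mem hΩb hx hx₀
    have h0 : 0 < M₁ * ρ₀ := by positivity
    linarith
  have hb2 : b ^ 2 ≤ C₂ * (J / (s₀ * ρ₀) ^ 4 + C₁ * I / (s₀ * ρ₀) ^ 2) := by
    rw [← ENNReal.ofReal_le_ofReal_iff (by positivity)]
    refine (hC₂ x₀ (s₀ * ρ₀) (by positivity) u w (fun i => (hu i).mono hball) (hw.mono hball)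
      ((lintegral_mono_set hball).trans_lt hg)
      ((lintegral_mono_set hball).trans_lt (hJ ▸ ENNReal.ofReal_lt_top)) b).trans ?_
    calc _ ≤ (C₂ : ENNReal) * (ENNReal.ofReal ((s₀ * ρ₀) ^ 4)⁻¹ * ENNReal.ofReal J +
          ENNReal.ofReal ((s₀ * ρ₀) ^ 2)⁻¹ * ENNReal.ofReal (C₁ * I)) := by
          rw [← hJ]
          gcongr
          exact (lintegral_mono_set hball).trans hb
      _ = _ := by
          rw [← ENNReal.ofReal_mul (by positivity), ← ENNReal.ofReal_mul (by positivity),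
            ← ENNReal.ofReal_add (by positivity) (by positivity),
            ← ENNReal.ofReal_coe_nnreal, ← ENNReal.ofReal_mul C₂.coe_nonneg]
          congr 1; ring
  calc ∫⁻ x in Ω, ENNReal.ofReal (gradSq u x)
      ≤ ∫⁻ x in Ω, (ENNReal.ofReal (strainSq u x) + 2 * ENNReal.ofReal ((rot u x - 0) ^ 2)) := by
        refine lintegral_mono fun x => ?_
        rw [two_mul, ← ENNReal.ofReal_add (by positivity) (by positivity),
          ← ENNReal.ofReal_add (strainSq_nonneg u x) (by positivity), gradSq_eq]
        refine ENNReal.ofReal_le_ofReal (le_of_eq ?_)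
        ring
    _ = ENNReal.ofReal I + 2 * ∫⁻ x in Ω, ENNReal.ofReal ((rot u x - 0) ^ 2) := by
        rw [lintegral_add_right _ (by fun_prop), lintegral_const_mul' _ _ (by norm_num), hI]
    _ ≤ ENNReal.ofReal I + 2 * (2 * (ENNReal.ofReal (C₁ * I) +
          ENNReal.ofReal (C₂ * (J / (s₀ * ρ₀) ^ 4 + C₁ * I / (s₀ * ρ₀) ^ 2)) *
            ENNReal.ofReal ((2 * (M₁ * ρ₀)) ^ 2 * V))) := by
        gcongr
        refine (setLIntegral_sq_sub_le _ Ω 0 b).trans ?_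
        rw [sub_zero]
        gcongr
    _ = ENNReal.ofReal (I + 4 * (C₁ * I + C₂ * (J / (s₀ * ρ₀) ^ 4 + C₁ * I / (s₀ * ρ₀) ^ 2) *
          ((2 * (M₁ * ρ₀)) ^ 2 * V))) := by
        rw [← ENNReal.ofReal_mul (by positivity), ← ENNReal.ofReal_add (by positivity)
          (by positivity), two_mul (ENNReal.ofReal _), ← ENNReal.ofReal_add (by positivity)
          (by positivity), two_mul (ENNReal.ofReal _), ← ENNReal.ofReal_add (by positivity)
          (by positivity), ← ENNReal.ofReal_add (by positivity) (by positivity)]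
        congr 1; ring
    _ ≤ _ := by
        refine ENNReal.ofReal_le_ofReal ?_
        obtain ⟨J', hJ'⟩ : ∃ J', J' = J / ρ₀ ^ 2 := ⟨_, rfl⟩
        have hJ'0 : 0 ≤ J' := by rw [hJ']; positivity
        have e : I + 4 * (C₁ * I + C₂ * (J / (s₀ * ρ₀) ^ 4 + C₁ * I / (s₀ * ρ₀) ^ 2) *
            ((2 * (M₁ * ρ₀)) ^ 2 * V)) =
            (1 + 4 * C₁ + 16 * M₁ ^ 2 * V * C₂ * C₁ / s₀ ^ 2) * I +
              16 * M₁ ^ 2 * V * C₂ / s₀ ^ 4 * J' := by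
          rw [hJ']; field_simp; ring
        rw [e, ← hJ']
        have h1 : 0 ≤ (1 + 4 * C₁ + 16 * M₁ ^ 2 * V * C₂ * C₁ / s₀ ^ 2) * J' := by positivity
        have h2 : 0 ≤ 16 * M₁ ^ 2 * V * C₂ / s₀ ^ 4 * I := by positivity
        linarith

lemma gradient_apply (w : Plane → ℝ) (x : Plane) (i : Fin 2) : gradient w x i = pd i w x := by
  have h := inner_gradient_left (𝕜 := ℝ) (f := w) (x := x) (y := EuclideanSpace.single i 1)
  rw [pd, ← h, EuclideanSpace.inner_single_right]
  simp

lemma norm_add_gradient_sq (φ : Plane → Plane) (w : Plane → ℝ) (x : Plane) :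
    ‖φ x + gradient w x‖ ^ 2 =
      shear (fun i y => φ y i) w 0 x ^ 2 + shear (fun i y => φ y i) w 1 x ^ 2 := by
  rw [norm_sq_eq_coords, PiLp.add_apply, PiLp.add_apply, gradient_apply, gradient_apply, shear,
    shear]

end KornPlate

open KornPlate

/-- generalized second Korn inequality
`‖∇φ‖_{L²(Ω)} ≤ C(‖∇̂φ‖_{L²(Ω)} + ρ₀⁻¹‖φ + ∇w‖_{L²(Ω)})`, with `C` depending
only on `M₀`, `M₁`, `s₀`. -/
theorem stmt_8 (M₀ M₁ s₀ : ℝ) (hM₀ : 0 < M₀) (hM₁ : 0 < M₁) (hs₀ : 0 < s₀) :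
    ∃ C > 0, ∀ (Ω : Set (EuclideanSpace ℝ (Fin 2))) (ρ₀ : ℝ)
      (x₀ : EuclideanSpace ℝ (Fin 2)), 0 < ρ₀ →
      IsOpen Ω → IsConnected Ω → Bornology.IsBounded Ω →
      LipschitzBoundary Ω ρ₀ M₀ →
      Metric.diam Ω ≤ M₁ * ρ₀ → ball x₀ (s₀ * ρ₀) ⊆ Ω →
      ∀ (φ : EuclideanSpace ℝ (Fin 2) → EuclideanSpace ℝ (Fin 2))
        (w : EuclideanSpace ℝ (Fin 2) → ℝ),
        (∀ i : Fin 2, DifferentiableOn ℝ (fun y => φ y i) Ω) →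
        DifferentiableOn ℝ w Ω →
        IntegrableOn (fun x => ∑ i : Fin 2, ∑ j : Fin 2,
          (fderiv ℝ (fun y => φ y i) x (EuclideanSpace.single j 1))^2) Ω →
        IntegrableOn (fun x => ‖φ x + gradient w x‖^2) Ω →
        Real.sqrt (∫ x in Ω, ∑ i : Fin 2, ∑ j : Fin 2,
            (fderiv ℝ (fun y => φ y i) x (EuclideanSpace.single j 1))^2) ≤
          C * (Real.sqrt (∫ x in Ω, ∑ i : Fin 2, ∑ j : Fin 2,
              ((fderiv ℝ (fun y => φ y i) x (EuclideanSpace.single j 1) +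
                fderiv ℝ (fun y => φ y j) x (EuclideanSpace.single i 1)) / 2)^2) +
            (1 / ρ₀) * Real.sqrt (∫ x in Ω, ‖φ x + gradient w x‖^2)) := by
  obtain ⟨A, hA, hbound⟩ := exists_lintegral_gradSq_le hM₀ hM₁ hs₀
  refine ⟨Real.sqrt A, Real.sqrt_pos.2 hA, ?_⟩
  intro Ω ρ₀ x₀ hρ₀ hΩo hΩc hΩb hΩ hd hball φ w hφ hw hG hS
  obtain ⟨u, hu⟩ : ∃ u : Fin 2 → Plane → ℝ, u = fun i y => φ y i := ⟨_, rfl⟩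
  have eG : ∀ x, ∑ i : Fin 2, ∑ j : Fin 2,
      (fderiv ℝ (fun y => φ y i) x (EuclideanSpace.single j 1)) ^ 2 = gradSq u x := fun x => by
    rw [hu]; rfl
  have eI : ∀ x, ∑ i : Fin 2, ∑ j : Fin 2,
      ((fderiv ℝ (fun y => φ y i) x (EuclideanSpace.single j 1) +
        fderiv ℝ (fun y => φ y j) x (EuclideanSpace.single i 1)) / 2) ^ 2 = strainSq u x :=
    fun x => by rw [hu]; rfl
  have eJ : ∀ x, ‖φ x + gradient w x‖ ^ 2 = shear u w 0 x ^ 2 + shear u w 1 x ^ 2 := fun x => by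
    rw [hu]; exact norm_add_gradient_sq φ w x
  simp only [eG] at hG ⊢
  simp only [eJ] at hS ⊢
  simp only [eI]
  have hstrain : IntegrableOn (strainSq u) Ω :=
    hG.mono' (measurable_strainSq u).aestronglyMeasurable (Filter.Eventually.of_forall fun x => by
      rw [Real.norm_eq_abs, abs_of_nonneg (strainSq_nonneg u x)]
      exact strainSq_le_gradSq u x)
  have lG := ofReal_integral_eq_lintegral_ofReal hG
    (Filter.Eventually.of_forall fun x => gradSq_nonneg u x)
  have lI := ofReal_integral_eq_lintegral_ofReal hstrain
    (Filter.Eventually.of_forall fun x => strainSq_nonneg u x)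
  have lJ := ofReal_integral_eq_lintegral_ofReal hS
    (Filter.Eventually.of_forall fun x => by positivity)
  have hI0 : 0 ≤ ∫ x in Ω, strainSq u x := integral_nonneg fun x => strainSq_nonneg u x
  have hJ0 : 0 ≤ ∫ x in Ω, (shear u w 0 x ^ 2 + shear u w 1 x ^ 2) :=
    integral_nonneg fun x => by positivity
  have main := hbound Ω ρ₀ x₀ hρ₀ hΩo hΩc hΩb hΩ hd hball u w (by rw [hu]; exact hφ) hw
    (lG ▸ ENNReal.ofReal_lt_top) _ _ hI0 hJ0 lI.symm lJ.symm
  rw [← lG, ENNReal.ofReal_le_ofReal_iff (by positivity)] at main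
  refine (Real.sqrt_le_sqrt main).trans ?_
  rw [Real.sqrt_mul hA.le]
  gcongr
  refine Real.sqrt_le_iff.2 ⟨by positivity, ?_⟩
  rw [add_sq, Real.sq_sqrt hI0, mul_pow, Real.sq_sqrt hJ0]
  have h1 : 0 ≤ 2 * Real.sqrt (∫ x in Ω, strainSq u x) *
    (1 / ρ₀ * Real.sqrt (∫ x in Ω, (shear u w 0 x ^ 2 + shear u w 1 x ^ 2))) := by positivity
  have h2 : (1 / ρ₀) ^ 2 * (∫ x in Ω, (shear u w 0 x ^ 2 + shear u w 1 x ^ 2)) =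
    (∫ x in Ω, (shear u w 0 x ^ 2 + shear u w 1 x ^ 2)) / ρ₀ ^ 2 := by
    field_simp
  linarith
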